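/- arXiv:math/0502146 — 2 statements merged into one kernel-verified Lean document; each statement's English description precedes it below -/
import Mathlib

section
/- Let k be an algebraically closed field and R = k[x_0,x_1,x_2,x_3]. Let H = {h_i} be a twice differentiable O-sequence with h_0 = 1, h_1 = 4, whose first difference ΔH is eventually constant with value d; let t be the least index with (ΔH)_t = d, set s = ⌊(d−1)/2⌋, and assume d > 3 and t ≤ s − 1. Let H̄ be the truncation of H at the value h_{s+1}, i.e., H̄(i) = min(h_i, h_{s+1}). Then there exist finite sets Z and Z' of points in P^3(k), both with Hilbert function H̄, such that: (i) there is a linear form L that is a nonzerodivisor on R/I_Z for which the Artinian reduction R/(I_Z + (L)) has the Weak Lefschetz Property; and (ii) for every linear form L' that is a nonzerodivisor on R/I_{Z'}, the Artinian reduction R/(I_{Z'} + (L')) has a nonzero socle element in degree s − 1 and does not have the Weak Lefschetz Property. -/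
/-!
STATEMENT 12 (Theorem 4.1, WLP part): with `H, b = ΔH, c = Δ²H, d, t, s` as in
the Basic Construction (`d > 3`, `t ≤ s − 1`, `s = ⌊(d−1)/2⌋`), and `H̄` the
truncation of `H` at the value `h_{s+1}`, there exist finite sets of points
`Z, Z'` in `P³(k)`, both with Hilbert function `H̄`, such that some Artinian
reduction of `R/I_Z` has the Weak Lefschetz Property, while every Artinian
reduction of `R/I_{Z'}` has a nonzero socle element in degree `s − 1` and
fails the Weak Lefschetz Property.
-/

open MvPolynomial

/-- Greedy top term `m_i` of the `i`-binomial expansion of `a`. -/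
def binomExpTop (a i : ℕ) : ℕ :=
  Nat.findGreatest (fun m => Nat.choose m i ≤ a) (a + i)

/-- Macaulay growth function: `macaulayGrow i a = a^⟨i⟩`, with `0^⟨i⟩ = 0`. -/
def macaulayGrow : ℕ → ℕ → ℕ
  | 0, _ => 0
  | (i + 1), a =>
    if a = 0 then 0
    else Nat.choose (binomExpTop a (i + 1) + 1) (i + 2)
      + macaulayGrow i (a - Nat.choose (binomExpTop a (i + 1)) (i + 1))

/-- O-sequence: `a_0 = 1` and `a_{i+1} ≤ a_i^⟨i⟩` for all `i ≥ 1`. -/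
def IsOSequence (a : ℕ → ℕ) : Prop :=
  a 0 = 1 ∧ ∀ i : ℕ, 1 ≤ i → a (i + 1) ≤ macaulayGrow i (a i)

/-- The degree-`i` graded piece of `R/I`. -/
noncomputable def quotPiece {k : Type*} [Field k] {n : ℕ}
    (I : Ideal (MvPolynomial (Fin n) k)) (i : ℕ) :
    Submodule k (MvPolynomial (Fin n) k ⧸ I) :=
  (MvPolynomial.homogeneousSubmodule (Fin n) k i).map (Ideal.Quotient.mkₐ k I).toLinearMap

/-- The Hilbert function of `R/I`. -/
noncomputable def hilbertFn {k : Type*} [Field k] {n : ℕ}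
    (I : Ideal (MvPolynomial (Fin n) k)) (i : ℕ) : ℕ :=
  Module.finrank k (quotPiece I i)

/-- The Weak Lefschetz Property for `R/I`. -/
def hasWLP {k : Type*} [Field k] {n : ℕ} (I : Ideal (MvPolynomial (Fin n) k)) : Prop :=
  ∃ L ∈ MvPolynomial.homogeneousSubmodule (Fin n) k 1,
    ∀ i : ℕ,
      (∀ x ∈ quotPiece I i, Ideal.Quotient.mk I L * x = 0 → x = 0) ∨
      (∀ y ∈ quotPiece I (i + 1), ∃ x ∈ quotPiece I i, Ideal.Quotient.mk I L * x = y)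

/-- The homogeneous vanishing ideal of a set of points in `P³(k)`: all
polynomials vanishing at every representative of every point of the set. -/
noncomputable def projVanishingIdeal (k : Type*) [Field k]
    (Z : Set (Projectivization k (Fin 4 → k))) : Ideal (MvPolynomial (Fin 4) k) :=
  ⨅ p ∈ Z, ⨅ (v : Fin 4 → k), ⨅ (hv : v ≠ 0), ⨅ (_ : Projectivization.mk k v hv = p),
    RingHom.ker (MvPolynomial.eval v)

section Comb
open Finset

lemma mg_zero (i : ℕ) : macaulayGrow i 0 = 0 := by
  cases i <;> simp [macaulayGrow]

lemma top_small (a i : ℕ) (h1 : 1 ≤ a) (h2 : a ≤ i) : binomExpTop a i = i := by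
  unfold binomExpTop
  rw [Nat.findGreatest_eq_iff]
  refine ⟨by omega, fun _ => by simpa using h1, fun n hn _ h => ?_⟩
  have : Nat.choose (i+1) i ≤ Nat.choose n i := Nat.choose_le_choose i hn
  rw [Nat.choose_succ_self_right] at this
  omega

lemma top_eq (i : ℕ) (hi : 1 ≤ i) : binomExpTop (i+1) i = i+1 := by
  unfold binomExpTop
  rw [Nat.findGreatest_eq_iff]
  refine ⟨by omega, fun _ => by simp, fun n hn _ h => ?_⟩
  have : Nat.choose (i+2) i ≤ Nat.choose n i := Nat.choose_le_choose i hn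
  have h3 : Nat.choose (i+2) i = Nat.choose (i+1) i + Nat.choose (i+1) (i-1) := by
    obtain ⟨j, rfl⟩ : ∃ j, i = j+1 := ⟨i-1, by omega⟩
    rw [Nat.choose_succ_succ' (j+2) j, add_comm]; rfl
  rw [Nat.choose_succ_self_right] at h3
  have : 0 < Nat.choose (i+1) (i-1) := Nat.choose_pos (by omega)
  omega

lemma mg_small (i a : ℕ) (h : a ≤ i) : macaulayGrow i a = a := by
  induction i generalizing a with
  | zero => simp [macaulayGrow]; omega
  | succ i ih =>
    rcases Nat.eq_zero_or_pos a with h0 | h0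
    · subst h0; exact mg_zero _
    · rw [macaulayGrow, if_neg (by omega), top_small a (i+1) h0 h]
      simp
      rw [ih _ (by omega)]; omega

lemma mg_eq (i : ℕ) (hi : 1 ≤ i) : macaulayGrow i (i+1) = i+2 := by
  obtain ⟨j, rfl⟩ : ∃ j, i = j+1 := ⟨i-1, by omega⟩
  rw [macaulayGrow, if_neg (by omega), top_eq (j+1) hi]
  simp [mg_zero]

lemma c_le (c : ℕ → ℕ) (hO : IsOSequence c) (h1 : c 1 = 2) (i : ℕ) : c i ≤ i + 1 := by
  induction i with
  | zero => simp [hO.1]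
  | succ i ih =>
    rcases Nat.eq_zero_or_pos i with h0 | h0
    · subst h0; rw [zero_add, h1]
    · have := hO.2 i h0
      rcases Nat.lt_or_ge (c i) (i+1) with h | h
      · rw [mg_small _ _ (by omega)] at this; omega
      · rw [show c i = i+1 by omega, mg_eq i h0] at this; omega

lemma c_step (c : ℕ → ℕ) (hO : IsOSequence c) (i : ℕ) : min (i+1) (c (i+1)) ≤ c i := by
  rcases Nat.eq_zero_or_pos i with h0 | h0
  · subst h0; simp [hO.1]
  · have := hO.2 i h0
    rcases Nat.lt_or_ge (c i) (i+1) with h | h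
    · rw [mg_small _ _ (by omega)] at this; omega
    · omega

lemma c_uni (c : ℕ → ℕ) (hO : IsOSequence c) (i m : ℕ) : min (m+1) (c (m+i)) ≤ c m := by
  induction i with
  | zero => simp
  | succ i ih =>
    have := c_step c hO (m+i)
    rw [← add_assoc]
    omega

/-- Number of monomials of degree `i` with first exponent less than `j`. -/
def lexPos (i j : ℕ) : ℕ := ∑ m ∈ range j, (i + 1 - m)

lemma lexPos_zero (i : ℕ) : lexPos i 0 = 0 := rfl
lemma lexPos_succ (i j : ℕ) : lexPos i (j+1) = lexPos i j + (i + 1 - j) := by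
  simp [lexPos, sum_range_succ]
lemma lexPos_mono (i : ℕ) {j j' : ℕ} (h : j ≤ j') : lexPos i j ≤ lexPos i j' := 
  sum_le_sum_of_subset (by simpa using h)
lemma lexPos_up (i j : ℕ) : lexPos (i+1) j = lexPos i j + min j (i+2) := by
  induction j with
  | zero => simp [lexPos_zero]
  | succ j ih => rw [lexPos_succ, lexPos_succ, ih]; omega

lemma b_ge (b c : ℕ → ℕ) (hc0 : c 0 = b 0) (hc : ∀ i : ℕ, b (i + 1) = b i + c (i + 1)) (e : ℕ) (i : ℕ)
    (h : ∀ m ≤ i, min (m+1) e ≤ c m) : lexPos i e ≤ b i := by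
  induction i with
  | zero => 
    have := h 0 le_rfl
    rw [← hc0]
    refine le_trans ?_ this
    rcases Nat.eq_zero_or_pos e with h0 | h0
    · subst h0; simp [lexPos_zero]
    · obtain ⟨f, rfl⟩ : ∃ f, e = f + 1 := ⟨e-1, by omega⟩
      clear this h h0
      simp
      induction f with
      | zero => simp [lexPos]
      | succ f ih => rw [lexPos_succ]; omega
  | succ i ih =>
    have := ih (fun m hm => h m (by omega))
    have h2 := h (i+1) le_rfl
    rw [lexPos_up, hc]; omega

lemma b_le (b c : ℕ → ℕ) (hc0 : c 0 = b 0) (hc : ∀ i : ℕ, b (i + 1) = b i + c (i + 1)) 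
    (h : ∀ m, c m ≤ m+1) (i : ℕ) : b i ≤ lexPos i (i+1) := by
  induction i with
  | zero => have := h 0; rw [← hc0]; simpa [lexPos] using this
  | succ i ih => 
    have := h (i+1)
    rw [hc, lexPos_succ, lexPos_up]; omega

lemma sum_min (i B j : ℕ) : ∑ m ∈ range j, min (i+1-m) (B - lexPos i m) = min B (lexPos i j) := by
  induction j with
  | zero => simp [lexPos_zero]
  | succ j ih => rw [sum_range_succ, ih, lexPos_succ]; omega

def deg3 (α : Fin 3 → ℕ) : ℕ := α 0 + α 1 + α 2

/-- lower closure from one-step closure -/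
lemma lower_of_step (S : Set (Fin 3 → ℕ)) (h : ∀ α ∈ S, ∀ j, 0 < α j → Function.update α j (α j - 1) ∈ S) 
    (α β : Fin 3 → ℕ) (hα : α ∈ S) (hle : β ≤ α) : β ∈ S := by
  induction hn : deg3 α - deg3 β generalizing α with
  | zero => 
    have h0 : β 0 ≤ α 0 := hle 0
    have h1 : β 1 ≤ α 1 := hle 1
    have h2 : β 2 ≤ α 2 := hle 2
    have : β = α := by
      ext j; unfold deg3 at hn; fin_cases j <;> simp <;> omega
    rwa [this]
  | succ n ih =>
    by_cases he : ∃ j, β j < α j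
    · obtain ⟨j, hj⟩ := he
      refine ih _ (h α hα j (by omega)) ?_ ?_
      · intro i
        by_cases hij : i = j
        · subst hij; simp; omega
        · simp [hij]; exact hle i
      · have h0 : β 0 ≤ α 0 := hle 0
        have h1 : β 1 ≤ α 1 := hle 1
        have h2 : β 2 ≤ α 2 := hle 2
        unfold deg3 at *
        fin_cases j <;> simp at * <;> omega
    · push Not at he
      have h0 := he 0; have h1 := he 1; have h2 := he 2
      unfold deg3 at hn; omega

/-- expBox containing all exponents of degree at most N -/
def expBox (N : ℕ) : Finset (Fin 3 → ℕ) := Fintype.piFinset (fun _ => range (N+1))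

lemma mem_expBox {N : ℕ} {α : Fin 3 → ℕ} (h : deg3 α ≤ N) : α ∈ expBox N := by
  unfold deg3 at h
  simp only [expBox, Fintype.mem_piFinset, mem_range]
  intro j; fin_cases j <;> simp <;> omega

/-- the lex order ideal -/
def lexT (b : ℕ → ℕ) (N : ℕ) : Finset (Fin 3 → ℕ) :=
  (expBox N).filter (fun α => deg3 α ≤ N ∧ lexPos (deg3 α) (α 0) + α 1 < b (deg3 α))

lemma mem_lexT {b : ℕ → ℕ} {N : ℕ} {α : Fin 3 → ℕ} :
    α ∈ lexT b N ↔ deg3 α ≤ N ∧ lexPos (deg3 α) (α 0) + α 1 < b (deg3 α) := by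
  simp only [lexT, mem_filter, and_iff_right_iff_imp]
  exact fun h => mem_expBox h.1

/-- the cylinder order ideal -/
def cylT (c : ℕ → ℕ) (N : ℕ) : Finset (Fin 3 → ℕ) :=
  (expBox N).filter (fun α => deg3 α ≤ N ∧ α 0 < c (α 0 + α 1))

lemma mem_cylT {c : ℕ → ℕ} {N : ℕ} {α : Fin 3 → ℕ} :
    α ∈ cylT c N ↔ deg3 α ≤ N ∧ α 0 < c (α 0 + α 1) := by
  simp only [cylT, mem_filter, and_iff_right_iff_imp]
  exact fun h => mem_expBox h.1

lemma lexT_lower (b c : ℕ → ℕ) (hc0 : c 0 = b 0) (hc : ∀ i : ℕ, b (i + 1) = b i + c (i + 1)) 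
    (hO : IsOSequence c) (N : ℕ) (α β : Fin 3 → ℕ) (hα : α ∈ lexT b N) (hle : β ≤ α) : β ∈ lexT b N := by
  refine lower_of_step (↑(lexT b N)) ?_ α β hα hle
  clear hα hle α β
  intro α hα j hj
  rw [mem_coe, mem_lexT] at *
  obtain ⟨i, hi⟩ : ∃ i, deg3 α = i + 1 := ⟨deg3 α - 1, by unfold deg3; fin_cases j <;> simp at hj <;> omega⟩
  set β := Function.update α j (α j - 1) with hβ
  have hd : deg3 β = i := by
    unfold deg3 at *; fin_cases j <;> simp [hβ] at * <;> omega
  have h0 : β 0 ≤ α 0 := by fin_cases j <;> simp [hβ]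
  have h1 : β 1 ≤ α 1 := by fin_cases j <;> simp [hβ]
  have h01 : β 0 + β 1 ≤ i := by unfold deg3 at hd; omega
  have hα01 : α 0 ≤ i+1 := by unfold deg3 at hi; omega
  rw [hi] at hα
  rw [hd]
  refine ⟨by omega, ?_⟩
  have hb := b_ge b c hc0 hc (c (i+1)) i (fun m hm => by
    have := c_uni c hO (i+1-m) m
    rwa [show m + (i+1-m) = i+1 by omega] at this)
  have h3 := hα.2
  rw [lexPos_up, hc] at h3
  rcases Nat.lt_or_ge (β 0) (c (i+1)) with h | h
  · have h4 := lexPos_mono i (show β 0 + 1 ≤ c (i+1) from h)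
    rw [lexPos_succ] at h4
    omega
  · have := lexPos_mono i h0
    omega

lemma cylT_lower (c : ℕ → ℕ) (hO : IsOSequence c) (N : ℕ) (α β : Fin 3 → ℕ) (hα : α ∈ cylT c N) (hle : β ≤ α) : β ∈ cylT c N := by
  rw [mem_cylT] at *
  have h0 : β 0 ≤ α 0 := hle 0
  have h1 : β 1 ≤ α 1 := hle 1
  have h2 : β 2 ≤ α 2 := hle 2
  refine ⟨by unfold deg3 at *; omega, ?_⟩
  have := c_uni c hO (α 0 + α 1 - (β 0 + β 1)) (β 0 + β 1)
  rw [show (β 0 + β 1) + (α 0 + α 1 - (β 0 + β 1)) = α 0 + α 1 by omega] at this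
  omega

lemma lexT_card (b : ℕ → ℕ) (N i : ℕ) (hi : i ≤ N) (hb : b i ≤ lexPos i (i+1)) :
    ((lexT b N).filter (fun α => deg3 α = i)).card = b i := by
  have h1 : b i = ∑ m ∈ range (i+1), min (i+1-m) (b i - lexPos i m) := by
    rw [sum_min]; omega
  have h2 : ((range (i+1)).sigma (fun m => range (min (i+1-m) (b i - lexPos i m)))).card = b i := by
    rw [card_sigma]; simp only [card_range]; exact h1.symm
  rw [← h2]
  refine card_nbij' (fun α => ⟨α 0, α 1⟩) (fun p => ![p.1, p.2, i - p.1 - p.2]) ?_ ?_ ?_ ?_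
  · intro α hα
    simp only [mem_coe, mem_filter, mem_lexT, mem_sigma, mem_range] at *
    obtain ⟨⟨h1, h3⟩, h4⟩ := hα
    rw [h4] at h3
    unfold deg3 at h4
    omega
  · intro p hp
    simp only [mem_coe, mem_filter, mem_lexT, mem_sigma, mem_range] at *
    have : deg3 ![p.1, p.2, i - p.1 - p.2] = i := by simp [deg3]; omega
    rw [this]
    simp
    omega
  · intro α hα
    simp only [mem_coe, mem_filter] at hα
    obtain ⟨_, h4⟩ := hα
    unfold deg3 at h4
    ext j; fin_cases j <;> simp; omega
  · intro p hp
    simp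

lemma cylT_card (b c : ℕ → ℕ) (hc0 : c 0 = b 0) (hc : ∀ i : ℕ, b (i + 1) = b i + c (i + 1)) 
    (hcl : ∀ m, c m ≤ m+1) (N i : ℕ) (hi : i ≤ N) :
    ((cylT c N).filter (fun α => deg3 α = i)).card = b i := by
  have h1 : b i = ∑ m ∈ range (i+1), c m := by
    clear hi
    induction i with
    | zero => simp [hc0]
    | succ i ih => rw [sum_range_succ, ← ih, hc]
  have h2 : ((range (i+1)).sigma (fun m => range (c m))).card = b i := by
    rw [card_sigma]; simp only [card_range]; exact h1.symm
  rw [← h2]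
  refine card_nbij' (fun α => ⟨α 0 + α 1, α 0⟩) (fun p => ![p.2, p.1 - p.2, i - p.1]) ?_ ?_ ?_ ?_
  · intro α hα
    simp only [mem_coe, mem_filter, mem_cylT, mem_sigma, mem_range] at *
    obtain ⟨⟨h1, h3⟩, h4⟩ := hα
    unfold deg3 at h4
    exact ⟨by omega, h3⟩
  · intro p hp
    simp only [mem_coe, mem_filter, mem_cylT, mem_sigma, mem_range] at *
    have h6 := hcl p.1
    have : deg3 ![p.2, p.1 - p.2, i - p.1] = i := by simp [deg3]; omega
    rw [this]
    simp
    rw [show p.2 + (p.1 - p.2) = p.1 by omega]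
    omega
  · intro α hα
    simp only [mem_coe, mem_filter] at hα
    obtain ⟨_, h4⟩ := hα
    unfold deg3 at h4
    ext j; fin_cases j <;> simp; omega
  · intro p hp
    simp only [mem_coe, mem_sigma, mem_range] at *
    have h6 := hcl p.1
    ext <;> simp; omega

lemma card_total (T : Finset (Fin 3 → ℕ)) (H b : ℕ → ℕ) (N : ℕ)
    (hb0 : b 0 = H 0) (hb : ∀ i : ℕ, H (i + 1) = H i + b (i + 1))
    (hT : ∀ α ∈ T, deg3 α ≤ N) (hcard : ∀ i ≤ N, (T.filter (fun α => deg3 α = i)).card = b i) (i : ℕ) :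
    (T.filter (fun α => deg3 α < i+1)).card = min (H i) (H N) := by
  have hmono : Monotone H := monotone_nat_of_le_succ (fun n => by rw [hb]; omega)
  have key : ∀ i ≤ N, (T.filter (fun α => deg3 α < i+1)).card = H i := by
    intro i
    induction i with
    | zero => intro h; rw [← hb0, ← hcard 0 h]; congr 1; ext; simp
    | succ i ih =>
      intro h
      rw [hb, ← hcard (i+1) h, ← ih (by omega), ← card_union_of_disjoint]
      · congr 1; ext α; simp only [mem_filter, mem_union]; grind
      · rw [disjoint_filter]; intros; omega
  rcases le_total i N with h | h
  · rw [key i h, min_eq_left (hmono h)]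
  · rw [min_eq_right (hmono h), ← key N le_rfl]
    congr 1; ext α; simp only [mem_filter]
    constructor
    · rintro ⟨h1, h2⟩; exact ⟨h1, by have := hT α h1; omega⟩
    · rintro ⟨h1, h2⟩; exact ⟨h1, by omega⟩

end Comb

section Points
variable {k : Type} [Field k]

/-- affine representative of the distraction point of an exponent vector -/
def dpt (a : ℕ → k) (α : Fin 3 → ℕ) : Fin 4 → k := Fin.cons 1 (fun j => a (α j))

lemma dpt_ne (a : ℕ → k) (α : Fin 3 → ℕ) : dpt a α ≠ 0 := by
  intro h
  have := congrFun h 0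
  simp [dpt] at this

open Classical in
/-- the set of points -/
noncomputable def dpts (a : ℕ → k) (T : Finset (Fin 3 → ℕ)) : Finset (Projectivization k (Fin 4 → k)) :=
  T.image (fun α => Projectivization.mk k (dpt a α) (dpt_ne a α))

/-- its vanishing ideal -/
noncomputable def dI (a : ℕ → k) (T : Finset (Fin 3 → ℕ)) : Ideal (MvPolynomial (Fin 4) k) :=
  projVanishingIdeal k (dpts a T : Set (Projectivization k (Fin 4 → k)))

/-- evaluation -/
noncomputable def dev (a : ℕ → k) (T : Finset (Fin 3 → ℕ)) : MvPolynomial (Fin 4) k →ₐ[k] (T → k) :=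
  aeval (fun j α => dpt a α j)

lemma dev_apply (a : ℕ → k) (T : Finset (Fin 3 → ℕ)) (F : MvPolynomial (Fin 4) k) (α : T) :
    dev a T F α = eval (dpt a α) F := by
  have : (Pi.evalAlgHom k (fun _ : T => k) α).comp (dev a T) = aeval (dpt a α) := by
    ext j; simp [dev]
  have h2 := congrArg (fun f => f F) this
  simpa [aeval_eq_eval] using h2

lemma mem_dI {a : ℕ → k} {T : Finset (Fin 3 → ℕ)} {F : MvPolynomial (Fin 4) k} :
    F ∈ dI a T ↔ ∀ α ∈ T, ∀ c : k, c ≠ 0 → eval (c • dpt a α) F = 0 := by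
  unfold dI projVanishingIdeal
  simp only [Submodule.mem_iInf, RingHom.mem_ker]
  constructor
  · intro h α hα c hc
    refine h (Projectivization.mk k (dpt a α) (dpt_ne a α)) ?_ (c • dpt a α) (smul_ne_zero hc (dpt_ne a α)) ?_
    · simp only [dpts, Finset.coe_image]; exact ⟨α, hα, rfl⟩
    · rw [Projectivization.mk_eq_mk_iff']; exact ⟨c, rfl⟩
  · intro h p hp v hv hvp
    simp only [dpts, Finset.coe_image] at hp
    obtain ⟨α, hα, rfl⟩ := hp
    rw [Projectivization.mk_eq_mk_iff'] at hvp
    obtain ⟨c, rfl⟩ := hvp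
    exact h α hα c (fun h => hv (by simp [h]))

lemma eval_smul_hom {F : MvPolynomial (Fin 4) k} {i : ℕ} (hF : F.IsHomogeneous i) (c : k) (v : Fin 4 → k) :
    eval (c • v) F = c ^ i * eval v F := by
  rw [eval_eq, eval_eq, Finset.mul_sum]
  refine Finset.sum_congr rfl (fun m hm => ?_)
  have : ∑ j, m j = i := by
    have := hF.degree_eq_sum_deg_support hm
    rw [this]
    exact (Finset.sum_subset (Finset.subset_univ _) (fun j _ hj => by simpa using hj)).symm
  have h2 : ∏ j, c ^ m j = c ^ i := by rw [Finset.prod_pow_eq_pow_sum, this]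
  have h3 : ∏ j ∈ m.support, c ^ m j = c ^ i := by
    rw [← h2]
    exact Finset.prod_subset (Finset.subset_univ _) (fun j _ hj => by simp at hj; simp [hj])
  simp only [Pi.smul_apply, smul_eq_mul, mul_pow, Finset.prod_mul_distrib, h3]
  ring

lemma dI_hom {a : ℕ → k} {T : Finset (Fin 3 → ℕ)} {F : MvPolynomial (Fin 4) k} {i : ℕ} (hF : F.IsHomogeneous i) :
    F ∈ dI a T ↔ dev a T F = 0 := by
  rw [mem_dI]
  constructor
  · intro h
    ext α
    rw [dev_apply]
    simpa using h α α.2 1 one_ne_zero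
  · intro h α hα c hc
    have := congrFun h ⟨α, hα⟩
    rw [dev_apply] at this
    rw [eval_smul_hom hF]
    simp at this
    simp [this]

lemma dI_comp [Infinite k] {a : ℕ → k} {T : Finset (Fin 3 → ℕ)} {F : MvPolynomial (Fin 4) k} (hF : F ∈ dI a T) (i : ℕ) :
    homogeneousComponent i F ∈ dI a T := by
  rw [dI_hom (homogeneousComponent_isHomogeneous i F)]
  rw [mem_dI] at hF
  ext α
  rw [dev_apply]
  let p : Polynomial k := ∑ j ∈ Finset.range (F.totalDegree + 1), Polynomial.C (eval (dpt a α) (homogeneousComponent j F)) * Polynomial.X ^ j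
  have hp : p = 0 := by
    refine Polynomial.eq_zero_of_infinite_isRoot p (Set.Infinite.mono (s := {0}ᶜ) ?_ (Set.finite_singleton _).infinite_compl)
    intro c hc
    have h1 := hF α α.2 c hc
    rw [← sum_homogeneousComponent F, map_sum] at h1
    simp only [Set.mem_ofPred_eq, Polynomial.IsRoot, p, Polynomial.eval_finsetSum, Polynomial.eval_mul, Polynomial.eval_C, Polynomial.eval_pow, Polynomial.eval_X]
    rw [← h1]
    refine Finset.sum_congr rfl (fun j _ => ?_)
    rw [eval_smul_hom (homogeneousComponent_isHomogeneous j F), mul_comm]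
  by_cases hi : i < F.totalDegree + 1
  · have h2 : p.coeff i = eval (dpt a α) (homogeneousComponent i F) := by
      simp only [p, Polynomial.finsetSum_coeff, Polynomial.coeff_C_mul, Polynomial.coeff_X_pow]
      simp
      intro h; omega
    rw [← h2, hp]; simp
  · rw [homogeneousComponent_eq_zero _ _ (by omega)]; simp

lemma comp_mul {L : MvPolynomial (Fin 4) k} (hL : L.IsHomogeneous 1) (Q : MvPolynomial (Fin 4) k) (i : ℕ) :
    homogeneousComponent (i+1) (L * Q) = L * homogeneousComponent i Q := by
  let _ := MvPolynomial.gradedAlgebra (R := k) (σ := Fin 4)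
  have := DirectSum.coe_decompose_mul_add_of_left_mem (homogeneousSubmodule (Fin 4) k) (i := 1) (j := i) (a := L) (b := Q) hL
  rw [add_comm] at this
  rw [← decomposition.decompose'_apply, ← decomposition.decompose'_apply]
  exact this

lemma comp_mul_zero {L : MvPolynomial (Fin 4) k} (hL : L.IsHomogeneous 1) (Q : MvPolynomial (Fin 4) k) :
    homogeneousComponent 0 (L * Q) = 0 := by
  have : coeff 0 L = 0 := hL.coeff_eq_zero (by simp)
  rw [homogeneousComponent_zero, ← constantCoeff_eq, map_mul, constantCoeff_eq, this]; simp

lemma mem_sup_span {I : Ideal (MvPolynomial (Fin 4) k)} {L F : MvPolynomial (Fin 4) k} :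
    F ∈ I ⊔ Ideal.span {L} ↔ ∃ Q, F - L * Q ∈ I := by
  rw [Submodule.mem_sup]
  constructor
  · rintro ⟨y, hy, z, hz, rfl⟩
    obtain ⟨Q, rfl⟩ := Ideal.mem_span_singleton'.1 hz
    exact ⟨Q, by rwa [mul_comm L, add_sub_cancel_right]⟩
  · rintro ⟨Q, hQ⟩
    exact ⟨_, hQ, L * Q, Ideal.mem_span_singleton'.2 ⟨Q, mul_comm _ _⟩, by ring⟩

lemma mem_K_zero [Infinite k] {a : ℕ → k} {T : Finset (Fin 3 → ℕ)} {L F : MvPolynomial (Fin 4) k}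
    (hL : L.IsHomogeneous 1) (hF : F.IsHomogeneous 0) (h : F ∈ dI a T ⊔ Ideal.span {L}) : dev a T F = 0 := by
  rw [mem_sup_span] at h
  obtain ⟨Q, hQ⟩ := h
  have := dI_comp hQ 0
  rw [map_sub, comp_mul_zero hL, sub_zero, homogeneousComponent_eq_self hF] at this
  exact (dI_hom hF).1 this

lemma mem_K_succ [Infinite k] {a : ℕ → k} {T : Finset (Fin 3 → ℕ)} {L F : MvPolynomial (Fin 4) k} {i : ℕ}
    (hL : L.IsHomogeneous 1) (hF : F.IsHomogeneous (i+1)) :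
    F ∈ dI a T ⊔ Ideal.span {L} ↔ ∃ Q, Q.IsHomogeneous i ∧ dev a T F = dev a T L * dev a T Q := by
  rw [mem_sup_span]
  constructor
  · rintro ⟨Q, hQ⟩
    refine ⟨homogeneousComponent i Q, homogeneousComponent_isHomogeneous i Q, ?_⟩
    have := dI_comp hQ (i+1)
    rw [map_sub, comp_mul hL, homogeneousComponent_eq_self hF] at this
    have h2 := (dI_hom (hF.sub (by rw [add_comm]; exact hL.mul (homogeneousComponent_isHomogeneous i Q)))).1 this
    rw [map_sub, map_mul, sub_eq_zero] at h2
    exact h2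
  · rintro ⟨Q, hQ, h⟩
    refine ⟨Q, ?_⟩
    rw [dI_hom (hF.sub (by rw [add_comm]; exact hL.mul hQ)), map_sub, map_mul, h, sub_self]

/-- the triangular functions -/
def dg (a : ℕ → k) (T : Finset (Fin 3 → ℕ)) (β : Fin 3 → ℕ) : T → k :=
  fun α => ∏ j, ∏ m ∈ Finset.range (β j), (a (α.1 j) - a m)

lemma dg_ne {a : ℕ → k} (ha : Function.Injective a) {T : Finset (Fin 3 → ℕ)} {β : Fin 3 → ℕ} {α : T} :
    dg a T β α ≠ 0 ↔ β ≤ α.1 := by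
  unfold dg
  simp only [Finset.prod_ne_zero_iff, Finset.mem_univ, true_imp_iff, Finset.mem_range, sub_ne_zero, ha.ne_iff]
  refine forall_congr' (fun j => ?_)
  constructor
  · intro h
    by_contra h2
    exact h (α.1 j) (not_le.1 h2) rfl
  · intro h m hm h2
    change β j ≤ α.1 j at h
    omega

lemma dg_zero {a : ℕ → k} (ha : Function.Injective a) {T : Finset (Fin 3 → ℕ)} (hT : IsLowerSet (T : Set (Fin 3 → ℕ)))
    {β : Fin 3 → ℕ} (hβ : β ∉ T) : dg a T β = 0 := by
  ext α
  by_contra h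
  exact hβ (hT ((dg_ne ha).1 h) α.2)

lemma dg_mul (a : ℕ → k) (T : Finset (Fin 3 → ℕ)) (β : Fin 3 → ℕ) (j : Fin 3) :
    dev a T (X j.succ) * dg a T β = dg a T (β + Pi.single j 1) + a (β j) • dg a T β := by
  ext α
  have h : dg a T (β + Pi.single j 1) α = (a (α.1 j) - a (β j)) * dg a T β α := by
    unfold dg
    rw [← Finset.mul_prod_erase Finset.univ _ (Finset.mem_univ j), ← Finset.mul_prod_erase Finset.univ (fun j => ∏ m ∈ Finset.range (β j), (a (α.1 j) - a m)) (Finset.mem_univ j)]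
    have : ∀ i ∈ Finset.univ.erase j, ∏ m ∈ Finset.range ((β + Pi.single j 1 : Fin 3 → ℕ) i), (a (α.1 i) - a m) = ∏ m ∈ Finset.range (β i), (a (α.1 i) - a m) := by
      intro i hi
      have : i ≠ j := Finset.ne_of_mem_erase hi
      simp [this]
    rw [Finset.prod_congr rfl this]
    simp [Finset.prod_range_succ]
    ring
  simp only [Pi.mul_apply, Pi.add_apply, Pi.smul_apply, smul_eq_mul, h, dev_apply, eval_X]
  simp [dpt]
  ring

/-- span of the triangular functions of degree less than `n` -/
def dW (a : ℕ → k) (T : Finset (Fin 3 → ℕ)) (n : ℕ) : Submodule k (T → k) :=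
  Submodule.span k (dg a T '' {β | deg3 β < n})

lemma dW_mono (a : ℕ → k) (T : Finset (Fin 3 → ℕ)) {n m : ℕ} (h : n ≤ m) : dW a T n ≤ dW a T m :=
  Submodule.span_mono (Set.image_mono (fun _ hx => lt_of_lt_of_le hx h))

lemma deg3_single (β : Fin 3 → ℕ) (j : Fin 3) : deg3 (β + Pi.single j 1) = deg3 β + 1 := by
  unfold deg3; fin_cases j <;> simp <;> omega

lemma dev_X0 (a : ℕ → k) (T : Finset (Fin 3 → ℕ)) : dev a T (X 0) = 1 := by
  ext α; simp [dev_apply, dpt]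

lemma X_mul_dW (a : ℕ → k) (T : Finset (Fin 3 → ℕ)) (j : Fin 4) {n : ℕ} {φ : T → k} (hφ : φ ∈ dW a T n) :
    dev a T (X j) * φ ∈ dW a T (n+1) := by
  induction hφ using Submodule.span_induction with
  | mem x hx =>
    obtain ⟨β, hβ, rfl⟩ := hx
    refine Fin.cases ?_ (fun j => ?_) j
    · rw [dev_X0, one_mul]
      exact Submodule.subset_span ⟨β, Nat.lt_succ_of_lt hβ, rfl⟩
    · rw [dg_mul]
      refine add_mem (Submodule.subset_span ⟨_, ?_, rfl⟩) (Submodule.smul_mem _ _ (Submodule.subset_span ⟨β, Nat.lt_succ_of_lt hβ, rfl⟩))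
      simp only [Set.mem_ofPred_eq, deg3_single] at *
      omega
  | zero => simp
  | add x y _ _ hx hy => rw [mul_add]; exact add_mem hx hy
  | smul c x _ hx => rw [mul_smul_comm]; exact Submodule.smul_mem _ _ hx

lemma one_mem_dW (a : ℕ → k) (T : Finset (Fin 3 → ℕ)) : (1 : T → k) ∈ dW a T 1 := by
  refine Submodule.subset_span ⟨0, by simp [deg3], ?_⟩
  ext α; simp [dg]

lemma dev_mem {a : ℕ → k} {T : Finset (Fin 3 → ℕ)} {i : ℕ} {F : MvPolynomial (Fin 4) k} (hF : F.IsHomogeneous i) :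
    dev a T F ∈ dW a T (i+1) := by
  have h0 : F ∈ homogeneousSubmodule (Fin 4) k i := hF
  rw [← homogeneousSubmodule_one_pow, homogeneousSubmodule_one_eq_span_X] at h0
  clear hF
  induction i generalizing F with
  | zero =>
    rw [pow_zero] at h0
    obtain ⟨c, rfl⟩ := Submodule.mem_one.1 h0
    rw [AlgHom.commutes, Algebra.algebraMap_eq_smul_one]
    exact Submodule.smul_mem _ _ (one_mem_dW a T)
  | succ i ih =>
    rw [pow_succ'] at h0
    induction h0 using Submodule.mul_induction_on' with
    | mem_mul_mem m hm n hn =>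
      have h1 := ih hn
      rw [map_mul]
      clear hn
      induction hm using Submodule.span_induction with
      | mem x hx => obtain ⟨j, rfl⟩ := hx; exact X_mul_dW a T j h1
      | zero => simp
      | add x y _ _ hx hy => rw [map_add, add_mul]; exact add_mem hx hy
      | smul c x _ hx => rw [map_smul, smul_mul_assoc]; exact Submodule.smul_mem _ _ hx
    | add x _ y _ hx hy => rw [map_add]; exact add_mem hx hy

lemma mem_dW {a : ℕ → k} {T : Finset (Fin 3 → ℕ)} {i : ℕ} {φ : T → k} (hφ : φ ∈ dW a T (i+1)) :
    ∃ F : MvPolynomial (Fin 4) k, F.IsHomogeneous i ∧ dev a T F = φ := by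
  induction hφ using Submodule.span_induction with
  | mem x hx =>
    obtain ⟨β, hβ, rfl⟩ := hx
    refine ⟨X 0 ^ (i - deg3 β) * ∏ j : Fin 3, ∏ m ∈ Finset.range (β j), (X j.succ - C (a m) * X 0), ?_, ?_⟩
    · have h1 : (∏ j : Fin 3, ∏ m ∈ Finset.range (β j), (X j.succ - C (a m) * X 0) : MvPolynomial (Fin 4) k).IsHomogeneous (∑ j : Fin 3, ∑ m ∈ Finset.range (β j), 1) := by
        refine IsHomogeneous.prod _ _ _ (fun j _ => IsHomogeneous.prod _ _ _ (fun m _ => ?_))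
        exact (isHomogeneous_X _ _).sub (isHomogeneous_C_mul_X _ _)
      have h2 : ∑ j : Fin 3, ∑ m ∈ Finset.range (β j), 1 = deg3 β := by
        simp [deg3, Fin.sum_univ_three]
      rw [h2] at h1
      have h3 := (isHomogeneous_X_pow (R := k) (0 : Fin 4) (i - deg3 β)).mul h1
      have h4 : i - deg3 β + deg3 β = i := by simp at hβ; omega
      rwa [h4] at h3
    · ext α
      simp [dev_apply, dg, dpt]
  | zero => exact ⟨0, isHomogeneous_zero _ _ _, by simp⟩
  | add x y _ _ hx hy =>
    obtain ⟨F, hF, rfl⟩ := hx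
    obtain ⟨G, hG, rfl⟩ := hy
    exact ⟨F + G, hF.add hG, by simp⟩
  | smul c x _ hx =>
    obtain ⟨F, hF, rfl⟩ := hx
    exact ⟨c • F, by rw [smul_eq_C_mul]; exact hF.C_mul c, by simp⟩

lemma dg_li {a : ℕ → k} (ha : Function.Injective a) (T : Finset (Fin 3 → ℕ)) :
    LinearIndependent k (fun β : T => dg a T β.1) := by
  rw [Fintype.linearIndependent_iff]
  intro f hf
  have key : ∀ n, ∀ β : T, deg3 β.1 = n → f β = 0 := by
    intro n
    induction n using Nat.strong_induction_on with
    | _ n ih =>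
      intro β hβ
      have h := congrFun hf β
      rw [Finset.sum_apply, Finset.sum_eq_single β] at h
      · simp only [Pi.smul_apply, smul_eq_mul, Pi.zero_apply, mul_eq_zero] at h
        exact h.resolve_right ((dg_ne ha).2 le_rfl)
      · intro γ _ hγ
        simp only [Pi.smul_apply, smul_eq_mul, mul_eq_zero]
        by_cases h1 : dg a T γ.1 β = 0
        · exact Or.inr h1
        · left
          have h2 : γ.1 ≤ β.1 := (dg_ne ha).1 h1
          refine ih (deg3 γ.1) ?_ γ rfl
          have h00 : γ.1 0 ≤ β.1 0 := h2 0
          have h01 : γ.1 1 ≤ β.1 1 := h2 1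
          have h02 : γ.1 2 ≤ β.1 2 := h2 2
          by_contra h3
          apply hγ
          ext j
          unfold deg3 at *
          fin_cases j <;> simp <;> omega
      · simp
  exact fun β => key _ β rfl

/-- basis of triangular functions -/
noncomputable def dB {a : ℕ → k} (ha : Function.Injective a) (T : Finset (Fin 3 → ℕ)) : Module.Basis T k (T → k) :=
  Module.Basis.mk (dg_li ha T) (by rw [(dg_li ha T).span_eq_top_of_card_eq_finrank' (by simp)])

lemma dB_apply {a : ℕ → k} (ha : Function.Injective a) (T : Finset (Fin 3 → ℕ)) (β : T) : dB ha T β = dg a T β.1 := by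
  simp [dB]

lemma mem_dW_iff {a : ℕ → k} (ha : Function.Injective a) {T : Finset (Fin 3 → ℕ)} (hT : IsLowerSet (T : Set (Fin 3 → ℕ)))
    (n : ℕ) (φ : T → k) : φ ∈ dW a T n ↔ ∀ β : T, n ≤ deg3 β.1 → (dB ha T).repr φ β = 0 := by
  constructor
  · intro h β hβ
    induction h using Submodule.span_induction with
    | mem x hx =>
      obtain ⟨γ, hγ, rfl⟩ := hx
      by_cases hm : γ ∈ T
      · have := (dB ha T).repr_self ⟨γ, hm⟩
        rw [dB_apply] at this
        rw [this, Finsupp.single_apply_eq_zero]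
        intro h; subst h; exact absurd hβ (not_le.2 hγ)
      · rw [dg_zero ha hT hm]; simp
    | zero => simp
    | add x y _ _ hx hy => simp [hx, hy]
    | smul c x _ hx => simp [hx]
  · intro h
    rw [← (dB ha T).sum_repr φ]
    refine Submodule.sum_mem _ (fun β _ => ?_)
    rcases Nat.lt_or_ge (deg3 β.1) n with h1 | h1
    · exact Submodule.smul_mem _ _ (Submodule.subset_span ⟨β.1, h1, (dB_apply ha T β).symm⟩)
    · rw [h β h1]; simp

lemma dW_finrank {a : ℕ → k} (ha : Function.Injective a) {T : Finset (Fin 3 → ℕ)} (hT : IsLowerSet (T : Set (Fin 3 → ℕ)))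
    (n : ℕ) : Module.finrank k (dW a T n) = (T.filter (fun α => deg3 α < n)).card := by
  have h1 : dW a T n = Submodule.span k (Set.range (fun β : T.filter (fun α => deg3 α < n) => dg a T β.1)) := by
    apply le_antisymm
    · refine Submodule.span_le.2 ?_
      rintro _ ⟨β, hβ, rfl⟩
      by_cases hm : β ∈ T
      · exact Submodule.subset_span ⟨⟨β, Finset.mem_filter.2 ⟨hm, hβ⟩⟩, rfl⟩
      · rw [dg_zero ha hT hm]; exact zero_mem _
    · refine Submodule.span_le.2 ?_
      rintro _ ⟨β, rfl⟩
      exact Submodule.subset_span ⟨β.1, (Finset.mem_filter.1 β.2).2, rfl⟩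
  have h2 : LinearIndependent k (fun β : T.filter (fun α => deg3 α < n) => dg a T β.1) :=
    (dg_li ha T).comp (fun β : T.filter (fun α => deg3 α < n) => (⟨β.1, (Finset.mem_filter.1 β.2).1⟩ : T))
      (fun x y h => Subtype.ext (congrArg (fun z : T => z.1) h))
  rw [h1, finrank_span_eq_card h2]
  simp

lemma dW_top {a : ℕ → k} (ha : Function.Injective a) {T : Finset (Fin 3 → ℕ)} (hT : IsLowerSet (T : Set (Fin 3 → ℕ)))
    {N n : ℕ} (hN : ∀ α ∈ T, deg3 α ≤ N) (hn : N < n) (φ : T → k) : φ ∈ dW a T n := by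
  rw [mem_dW_iff ha hT]
  intro β hβ
  have := hN β.1 β.2
  omega

lemma mem_quotPiece {I : Ideal (MvPolynomial (Fin 4) k)} {i : ℕ} {x : MvPolynomial (Fin 4) k ⧸ I} :
    x ∈ quotPiece I i ↔ ∃ F : MvPolynomial (Fin 4) k, F.IsHomogeneous i ∧ Ideal.Quotient.mk I F = x := by
  unfold quotPiece
  rw [Submodule.mem_map]
  rfl

lemma dI_hilbert {a : ℕ → k} (ha : Function.Injective a) {T : Finset (Fin 3 → ℕ)} (hT : IsLowerSet (T : Set (Fin 3 → ℕ)))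
    (i : ℕ) : hilbertFn (dI a T) i = (T.filter (fun α => deg3 α < i + 1)).card := by
  rw [← dW_finrank ha hT]
  unfold hilbertFn
  let f := (Ideal.Quotient.mkₐ k (dI a T)).toLinearMap.domRestrict (homogeneousSubmodule (Fin 4) k i)
  let g := (dev a T).toLinearMap.domRestrict (homogeneousSubmodule (Fin 4) k i)
  have hf : LinearMap.range f = quotPiece (dI a T) i := by
    rw [LinearMap.range_domRestrict]; rfl
  have hg : LinearMap.range g = dW a T (i+1) := by
    rw [LinearMap.range_domRestrict]
    apply le_antisymm
    · rintro _ ⟨F, hF, rfl⟩; exact dev_mem hF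
    · intro φ hφ
      obtain ⟨F, hF, rfl⟩ := mem_dW hφ
      exact ⟨F, hF, rfl⟩
  have hk : LinearMap.ker f = LinearMap.ker g := by
    ext F
    rw [LinearMap.mem_ker, LinearMap.mem_ker]
    have h1 : f F = 0 ↔ F.1 ∈ dI a T := Ideal.Quotient.eq_zero_iff_mem
    rw [h1, dI_hom F.2]; rfl
  rw [← hf, ← hg]
  exact (f.quotKerEquivRange.symm.trans ((Submodule.quotEquivOfEq _ _ hk).trans g.quotKerEquivRange)).finrank_eq

lemma X0_nzd {a : ℕ → k} {T : Finset (Fin 3 → ℕ)} (F : MvPolynomial (Fin 4) k) (h : F * X 0 ∈ dI a T) : F ∈ dI a T := by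
  rw [mem_dI] at *
  intro α hα c hc
  have := h α hα c hc
  rw [map_mul, mul_eq_zero] at this
  refine this.resolve_right ?_
  simpa [dpt] using hc

lemma mem_K_X0 [Infinite k] {a : ℕ → k} {T : Finset (Fin 3 → ℕ)} {F : MvPolynomial (Fin 4) k} {i : ℕ}
    (hF : F.IsHomogeneous i) : F ∈ dI a T ⊔ Ideal.span {X 0} ↔ dev a T F ∈ dW a T i := by
  have hX : (X 0 : MvPolynomial (Fin 4) k).IsHomogeneous 1 := isHomogeneous_X _ _
  cases i with
  | zero =>
    constructor
    · intro h; rw [mem_K_zero hX hF h]; exact zero_mem _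
    · intro h
      simp only [dW, Nat.not_lt_zero] at h
      have h2 : dev a T F = 0 := by simpa using h
      exact Ideal.mem_sup_left ((dI_hom hF).2 h2)
  | succ i =>
    rw [mem_K_succ hX hF, dev_X0]
    constructor
    · rintro ⟨Q, hQ, h⟩; rw [h, one_mul]; exact dev_mem hQ
    · intro h
      obtain ⟨Q, hQ, h2⟩ := mem_dW h
      exact ⟨Q, hQ, by rw [h2, one_mul]⟩

lemma wlp_cyl [Infinite k] {a : ℕ → k} (ha : Function.Injective a) {T : Finset (Fin 3 → ℕ)} (hT : IsLowerSet (T : Set (Fin 3 → ℕ)))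
    {N : ℕ} (hN : ∀ α ∈ T, deg3 α ≤ N) (hup : ∀ α ∈ T, deg3 α < N → α + Pi.single 2 1 ∈ T) :
    hasWLP (dI a T ⊔ Ideal.span {X 0}) := by
  have hX : (X (Fin.succ 2) : MvPolynomial (Fin 4) k).IsHomogeneous 1 := isHomogeneous_X _ _
  refine ⟨X (Fin.succ 2), hX, fun i => ?_⟩
  rcases Nat.lt_or_ge i N with hi | hi
  · left
    intro x hx h
    obtain ⟨F, hF, rfl⟩ := mem_quotPiece.1 hx
    rw [← map_mul, Ideal.Quotient.eq_zero_iff_mem] at h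
    rw [Ideal.Quotient.eq_zero_iff_mem]
    have hXF := hX.mul hF
    rw [add_comm] at hXF
    rw [mem_K_X0 hXF] at h
    rw [mem_K_X0 hF]
    have hF' := (mem_dW_iff ha hT _ _).1 (dev_mem (a := a) (T := T) hF)
    rw [mem_dW_iff ha hT] at h ⊢
    intro β hβ
    rcases Nat.lt_or_ge i (deg3 β.1) with h1 | h1
    · exact hF' β h1
    have hβi : deg3 β.1 = i := by omega
    have hγ := hup β.1 β.2 (by omega)
    set γ : T := ⟨β.1 + Pi.single 2 1, hγ⟩ with hγd
    have hγdeg : deg3 γ.1 = i + 1 := by rw [hγd, deg3_single, hβi]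
    have h2 := h γ (by omega)
    rw [map_mul] at h2
    set f := (dB ha T).repr (dev a T F) with hf
    have h3 : dev a T (X (Fin.succ 2)) * dev a T F =
        ∑ δ : T, f δ • (dg a T (δ.1 + Pi.single 2 1) + a (δ.1 2) • dg a T δ.1) := by
      conv_lhs => rw [← (dB ha T).sum_repr (dev a T F)]
      rw [Finset.mul_sum]
      refine Finset.sum_congr rfl (fun δ _ => ?_)
      rw [mul_smul_comm, dB_apply, dg_mul]
    rw [h3, map_sum, Finsupp.finsetSum_apply, Finset.sum_eq_single β] at h2
    · have e1 : dg a T (β.1 + Pi.single 2 1) = dB ha T γ := by rw [dB_apply]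
      have hne : γ ≠ β := by intro h; rw [h] at hγdeg; omega
      rw [e1, ← dB_apply ha T β] at h2
      simpa [Finsupp.single_apply, hne.symm] using h2
    · intro δ _ hδ
      rw [map_smul, map_add, map_smul, Finsupp.smul_apply, Finsupp.add_apply, Finsupp.smul_apply, ← dB_apply ha T δ, Module.Basis.repr_self]
      by_cases hδγ : δ = γ
      · rw [hδγ, hF' γ (by omega)]; simp
      · rw [Finsupp.single_eq_of_ne' hδγ]
        by_cases hm : δ.1 + Pi.single 2 1 ∈ T
        · rw [show dg a T (δ.1 + Pi.single 2 1) = dB ha T ⟨_, hm⟩ by rw [dB_apply], Module.Basis.repr_self, Finsupp.single_eq_of_ne']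
          · simp
          · intro h
            apply hδ
            rw [hγd, Subtype.mk.injEq] at h
            exact Subtype.ext (add_right_cancel h)
        · rw [dg_zero ha hT hm]; simp
    · simp
  · right
    intro y hy
    refine ⟨0, zero_mem _, ?_⟩
    obtain ⟨F, hF, rfl⟩ := mem_quotPiece.1 hy
    rw [mul_zero, eq_comm, Ideal.Quotient.eq_zero_iff_mem, mem_K_X0 hF]
    exact dW_top ha hT hN (by omega) _

lemma nzd_ne {a : ℕ → k} (ha : Function.Injective a) {T : Finset (Fin 3 → ℕ)} (hT : IsLowerSet (T : Set (Fin 3 → ℕ)))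
    {N : ℕ} (hN : ∀ α ∈ T, deg3 α ≤ N) {L : MvPolynomial (Fin 4) k} (hL : L.IsHomogeneous 1)
    (h : ∀ F, F * L ∈ dI a T → F ∈ dI a T) (α : T) : dev a T L α ≠ 0 := by
  classical
  intro h0
  obtain ⟨F, hF, h1⟩ := mem_dW (dW_top ha hT hN (Nat.lt_succ_self N) (Pi.single α 1))
  have h2 : dev a T F = 0 := by
    rw [← dI_hom hF]
    apply h
    rw [dI_hom (hF.mul hL), map_mul, h1]
    ext β
    by_cases hβ : β = α
    · subst hβ; simp [h0]
    · simp [hβ]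
  rw [h1] at h2
  have := congrFun h2 α
  simp at this

lemma soc_mul {a : ℕ → k} (ha : Function.Injective a) {T : Finset (Fin 3 → ℕ)} (hT : IsLowerSet (T : Set (Fin 3 → ℕ)))
    (m : T) (hm : ∀ j, m.1 + Pi.single j 1 ∉ T) (ψ : T → k) : ψ * dg a T m.1 = ψ m • dg a T m.1 := by
  ext α
  by_cases h : α = m
  · subst h; simp
  · have : dg a T m.1 α = 0 := by
      by_contra h1
      have h2 : m.1 ≤ α.1 := (dg_ne ha).1 h1
      apply h
      by_contra h3
      have : ∃ j, m.1 j < α.1 j := by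
        by_contra h4
        push Not at h4
        exact h3 (Subtype.ext (funext fun j => le_antisymm (h4 j) (h2 j)))
      obtain ⟨j, hj⟩ := this
      refine hm j (hT (a := α.1) ?_ α.2)
      intro i
      by_cases hij : i = j
      · subst hij; simpa using hj
      · simpa [hij] using h2 i
    simp [this]

lemma lin_mul_dW {a : ℕ → k} {T : Finset (Fin 3 → ℕ)} {L : MvPolynomial (Fin 4) k} (hL : L.IsHomogeneous 1)
    {n : ℕ} {φ : T → k} (hφ : φ ∈ dW a T (n+1)) : dev a T L * φ ∈ dW a T (n+2) := by
  obtain ⟨F, hF, rfl⟩ := mem_dW hφ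
  rw [← map_mul]
  have := hL.mul hF
  rw [add_comm] at this
  exact dev_mem this

lemma not_wlp [Infinite k] {a : ℕ → k} (ha : Function.Injective a) {T : Finset (Fin 3 → ℕ)} (hT : IsLowerSet (T : Set (Fin 3 → ℕ)))
    {N : ℕ} (hN : ∀ α ∈ T, deg3 α ≤ N) (m : T) (hm : ∀ j, m.1 + Pi.single j 1 ∉ T) (r : ℕ) (hr : deg3 m.1 = r + 1)
    (hcard : 2 * (T.filter (fun α => deg3 α < r + 2)).card ≤
      (T.filter (fun α => deg3 α < r + 1)).card + (T.filter (fun α => deg3 α < r + 3)).card)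
    {L : MvPolynomial (Fin 4) k} (hL : L.IsHomogeneous 1)
    (h : ∀ F, F * L ∈ dI a T → F ∈ dI a T) :
    (∃ x ∈ quotPiece (dI a T ⊔ Ideal.span {L}) (r+1), x ≠ 0 ∧
      ∀ l ∈ quotPiece (dI a T ⊔ Ideal.span {L}) 1, l * x = 0) ∧
    ¬ hasWLP (dI a T ⊔ Ideal.span {L}) := by
  have hL0 := nzd_ne ha hT hN hL h
  have hgm : dg a T m.1 ∈ dW a T (r+2) := Submodule.subset_span ⟨m.1, by simp [hr], rfl⟩
  have hgm' : dg a T m.1 ∉ dW a T (r+1) := by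
    rw [mem_dW_iff ha hT]
    intro h
    have := h m (by omega)
    rw [← dB_apply ha T m, Module.Basis.repr_self] at this
    simp at this
  obtain ⟨F, hF, hFg⟩ := mem_dW hgm
  -- dg m is not a multiple of L by something of smaller degree
  have hnot : ∀ φ ∈ dW a T (r+1), dg a T m.1 ≠ dev a T L * φ := by
    intro φ hφ he
    apply hgm'
    have h1 : dev a T L * φ = dev a T L * ((dev a T L m)⁻¹ • dg a T m.1) := by
      rw [mul_smul_comm, soc_mul ha hT m hm, smul_smul, inv_mul_cancel₀ (hL0 m), one_smul, he]
    have h2 : φ = (dev a T L m)⁻¹ • dg a T m.1 := by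
      ext α
      exact mul_left_cancel₀ (hL0 α) (congrFun h1 α)
    have h3 : dg a T m.1 = dev a T L m • φ := by
      rw [h2, smul_smul, mul_inv_cancel₀ (hL0 m), one_smul]
    rw [h3]
    exact Submodule.smul_mem _ _ hφ
  set K := dI a T ⊔ Ideal.span {L} with hK
  have hx0 : Ideal.Quotient.mk K F ≠ 0 := by
    rw [Ne, Ideal.Quotient.eq_zero_iff_mem, hK, mem_K_succ hL hF]
    rintro ⟨Q, hQ, h1⟩
    rw [hFg] at h1
    exact hnot _ (dev_mem hQ) h1
  have hsoc : ∀ l ∈ quotPiece K 1, l * Ideal.Quotient.mk K F = 0 := by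
    intro l hl
    obtain ⟨G, hG, rfl⟩ := mem_quotPiece.1 hl
    rw [← map_mul, Ideal.Quotient.eq_zero_iff_mem, hK, mem_K_succ hL (i := r+1) (by rw [add_comm]; exact hG.mul hF)]
    refine ⟨C (dev a T G m * (dev a T L m)⁻¹) * F, hF.C_mul _, ?_⟩
    rw [map_mul, hFg, soc_mul ha hT m hm, ← smul_eq_C_mul, map_smul, hFg, mul_smul_comm, soc_mul ha hT m hm, smul_smul,
      mul_assoc, inv_mul_cancel₀ (hL0 m), mul_one]
  have hxm : Ideal.Quotient.mk K F ∈ quotPiece K (r+1) := mem_quotPiece.2 ⟨F, hF, rfl⟩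
  refine ⟨⟨_, hxm, hx0, hsoc⟩, ?_⟩
  rintro ⟨M, hM, hw⟩
  have hM1 : M.IsHomogeneous 1 := hM
  rcases hw (r+1) with hinj | hsurj
  · exact hx0 (hinj _ hxm (hsoc _ (mem_quotPiece.2 ⟨M, hM1, rfl⟩)))
  · let mL : (T → k) →ₗ[k] (T → k) := LinearMap.mulLeft k (dev a T L)
    let mM : (T → k) →ₗ[k] (T → k) := LinearMap.mulLeft k (dev a T M)
    have hmL : Function.Injective mL := by
      intro x y hxy
      ext α
      exact mul_left_cancel₀ (hL0 α) (congrFun hxy α)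
    let A := (dW a T (r+2)).map mL
    let U := (dW a T (r+1)).map mL ⊔ Submodule.span k {dg a T m.1}
    have hU : U ≤ dW a T (r+2) := by
      refine sup_le ?_ (by rw [Submodule.span_singleton_le_iff_mem]; exact hgm)
      rintro _ ⟨φ, hφ, rfl⟩
      exact lin_mul_dW hL hφ
    have hUr : Module.finrank k U = (T.filter (fun α => deg3 α < r + 1)).card + 1 := by
      have h1 := Submodule.finrank_sup_add_finrank_inf_eq ((dW a T (r+1)).map mL) (Submodule.span k {dg a T m.1})
      have hg0 : dg a T m.1 ≠ 0 := fun h => hgm' (by rw [h]; exact zero_mem _)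
      have h2 : (dW a T (r+1)).map mL ⊓ Submodule.span k {dg a T m.1} = ⊥ := by
        rw [← disjoint_iff, Submodule.disjoint_span_singleton' hg0]
        rintro ⟨φ, hφ, h3⟩
        exact hnot φ hφ h3.symm
      rw [h2, finrank_bot, add_zero, finrank_span_singleton hg0, ← (Submodule.equivMapOfInjective mL hmL _).finrank_eq, dW_finrank ha hT] at h1
      exact h1
    obtain ⟨C0, hC0⟩ := Submodule.exists_isCompl U
    let C1 := C0 ⊓ dW a T (r+2)
    have hsup : U ⊔ C1 = dW a T (r+2) := by
      rw [← sup_inf_assoc_of_le _ hU, hC0.sup_eq_top, top_inf_eq]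
    have hinf : U ⊓ C1 = ⊥ := by
      rw [← inf_assoc, hC0.inf_eq_bot, bot_inf_eq]
    have hCr : Module.finrank k C1 + Module.finrank k U = (T.filter (fun α => deg3 α < r + 2)).card := by
      have h1 := Submodule.finrank_sup_add_finrank_inf_eq U C1
      rw [hsup, hinf, finrank_bot, dW_finrank ha hT] at h1
      omega
    have hAr : Module.finrank k A = (T.filter (fun α => deg3 α < r + 2)).card := by
      rw [← (Submodule.equivMapOfInjective mL hmL _).finrank_eq, dW_finrank ha hT]
    have hMU : U.map mM ≤ A := by
      rw [Submodule.map_sup]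
      refine sup_le ?_ ?_
      · rintro _ ⟨_, ⟨φ, hφ, rfl⟩, rfl⟩
        exact ⟨dev a T M * φ, lin_mul_dW hM1 hφ, mul_left_comm _ _ _⟩
      · rw [Submodule.map_span, Set.image_singleton, Submodule.span_singleton_le_iff_mem]
        refine ⟨(dev a T M m * (dev a T L m)⁻¹) • dg a T m.1, Submodule.smul_mem _ _ hgm, ?_⟩
        change dev a T L * _ = dev a T M * _
        rw [mul_smul_comm, soc_mul ha hT m hm, soc_mul ha hT m hm, smul_smul,
          mul_assoc, inv_mul_cancel₀ (hL0 m), mul_one]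
    have hbig : dW a T (r+3) ≤ A ⊔ C1.map mM := by
      intro φ hφ
      obtain ⟨G, hG, rfl⟩ := mem_dW hφ
      obtain ⟨x, hx, hxe⟩ := hsurj (Ideal.Quotient.mk K G) (mem_quotPiece.2 ⟨G, hG, rfl⟩)
      obtain ⟨P, hP, rfl⟩ := mem_quotPiece.1 hx
      have hMP : (M * P).IsHomogeneous (r+1+1) := by rw [add_comm (r+1)]; exact hM1.mul hP
      rw [← map_mul, eq_comm, Ideal.Quotient.eq, hK, mem_K_succ hL (i := r+1) (hG.sub hMP)] at hxe
      obtain ⟨Q, hQ, hQe⟩ := hxe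
      have h1 : dev a T G = dev a T L * dev a T Q + dev a T M * dev a T P := by
        rw [← hQe, map_sub, map_mul]; ring
      rw [h1]
      refine add_mem (Submodule.mem_sup_left ⟨_, dev_mem hQ, rfl⟩) ?_
      have h2 : dev a T P ∈ U ⊔ C1 := by rw [hsup]; exact dev_mem hP
      have h3 : mM (dev a T P) ∈ (U ⊔ C1).map mM := ⟨_, h2, rfl⟩
      rw [Submodule.map_sup] at h3
      exact sup_le_sup_right hMU _ h3
    have h1 := Submodule.finrank_mono hbig
    have h2 := Submodule.finrank_add_le_finrank_add_finrank A (C1.map mM)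
    have h3 := Submodule.finrank_map_le mM C1
    rw [dW_finrank ha hT] at h1
    omega
end Points

theorem reducible_postulation_scheme_wlp
    (k : Type) [Field k] [IsAlgClosed k]
    (H b c : ℕ → ℕ) (d t s : ℕ)
    (hH0 : H 0 = 1) (hH1 : H 1 = 4)
    (hb0 : b 0 = H 0) (hb : ∀ i : ℕ, H (i + 1) = H i + b (i + 1))
    (hc0 : c 0 = b 0) (hc : ∀ i : ℕ, b (i + 1) = b i + c (i + 1))
    (hOH : IsOSequence H) (hOb : IsOSequence b) (hOc : IsOSequence c)
    (hev : ∃ N : ℕ, ∀ i : ℕ, N ≤ i → b i = d)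
    (htd : b t = d) (htmin : ∀ i : ℕ, i < t → b i ≠ d)
    (hs : s = (d - 1) / 2)
    (hd : 3 < d) (hts : t ≤ s - 1) :
    ∃ Z Z' : Finset (Projectivization k (Fin 4 → k)),
      -- both have Hilbert function the truncation H̄ of H at the value h_{s+1}
      (∀ i : ℕ, hilbertFn (projVanishingIdeal k (Z : Set (Projectivization k (Fin 4 → k)))) i = min (H i) (H (s + 1))) ∧
      (∀ i : ℕ, hilbertFn (projVanishingIdeal k (Z' : Set (Projectivization k (Fin 4 → k)))) i = min (H i) (H (s + 1))) ∧
      -- (i) some Artinian reduction of R/I_Z has the WLP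
      (∃ L ∈ MvPolynomial.homogeneousSubmodule (Fin 4) k 1,
        (∀ a : MvPolynomial (Fin 4) k,
          a * L ∈ projVanishingIdeal k (Z : Set (Projectivization k (Fin 4 → k))) → a ∈ projVanishingIdeal k (Z : Set (Projectivization k (Fin 4 → k)))) ∧
        hasWLP (projVanishingIdeal k (Z : Set (Projectivization k (Fin 4 → k))) ⊔ Ideal.span {L})) ∧
      -- (ii) every Artinian reduction of R/I_{Z'} has a nonzero socle element in
      -- degree s − 1 and fails the WLP
      (∀ L' ∈ MvPolynomial.homogeneousSubmodule (Fin 4) k 1,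
        (∀ a : MvPolynomial (Fin 4) k,
          a * L' ∈ projVanishingIdeal k (Z' : Set (Projectivization k (Fin 4 → k))) → a ∈ projVanishingIdeal k (Z' : Set (Projectivization k (Fin 4 → k)))) →
        ((∃ x ∈ quotPiece (projVanishingIdeal k (Z' : Set (Projectivization k (Fin 4 → k))) ⊔ Ideal.span {L'}) (s - 1),
            x ≠ 0 ∧
            ∀ ℓ ∈ quotPiece (projVanishingIdeal k (Z' : Set (Projectivization k (Fin 4 → k))) ⊔ Ideal.span {L'}) 1,
              ℓ * x = 0) ∧
          ¬ hasWLP (projVanishingIdeal k (Z' : Set (Projectivization k (Fin 4 → k))) ⊔ Ideal.span {L'}))) := by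
  
  classical
  have : Infinite k := IsAlgClosed.instInfinite
  let a : ℕ → k := Infinite.natEmbedding k
  have ha : Function.Injective a := (Infinite.natEmbedding k).injective
  have hc1 : c 1 = 2 := by
    have h1 := hb 0
    have h2 := hc 0
    simp only [zero_add] at h1 h2
    omega
  have hcl := c_le c hOc hc1
  have hbl := b_le b c hc0 hc hcl
  have hbmono : Monotone b := monotone_nat_of_le_succ (fun n => by rw [hc]; omega)
  have hbd : ∀ i, t ≤ i → b i = d := by
    intro i hi
    obtain ⟨M, hM⟩ := hev
    have h1 := hbmono hi
    have h2 := hbmono (le_max_left i M)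
    have h3 := hM _ (le_max_right i M)
    omega
  have hs4 : 4 ≤ s := by
    by_contra hlt
    have h1 := hbd (s-1) hts
    have h2 := hbl (s-1)
    have hcases : s = 1 ∨ s = 2 ∨ s = 3 := by omega
    rcases hcases with h | h | h <;> subst h <;> simp [lexPos, Finset.sum_range_succ] at h1 h2 <;> omega
  obtain ⟨r, rfl⟩ : ∃ r, s = r + 4 := ⟨s - 4, by omega⟩
  let T := cylT c (r+4+1)
  let T' := lexT b (r+4+1)
  have hT : IsLowerSet (T : Set (Fin 3 → ℕ)) := fun α β hle hα => cylT_lower c hOc _ α β hα hle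
  have hT' : IsLowerSet (T' : Set (Fin 3 → ℕ)) := fun α β hle hα => lexT_lower b c hc0 hc hOc _ α β hα hle
  have hN : ∀ α ∈ T, deg3 α ≤ r+4+1 := fun α hα => (mem_cylT.1 hα).1
  have hN' : ∀ α ∈ T', deg3 α ≤ r+4+1 := fun α hα => (mem_lexT.1 hα).1
  have hcT := card_total T H b (r+4+1) hb0 hb hN (fun i hi => cylT_card b c hc0 hc hcl _ i hi)
  have hcT' := card_total T' H b (r+4+1) hb0 hb hN' (fun i hi => lexT_card b _ i hi (hbl i))
  have hp2 : ∀ i, lexPos (i+2) 2 = 2 * i + 5 := by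
    intro i; simp [lexPos, Finset.sum_range_succ]; omega
  have hp3 : ∀ i, lexPos (i+2) 3 = 3 * i + 6 := by
    intro i; simp [lexPos, Finset.sum_range_succ]; omega
  have hb3 : b (r+3) = d := hbd _ (by omega)
  have hb4 : b (r+4) = d := hbd _ (by omega)
  have hm : ![2, 1, r] ∈ T' := by
    have hdeg : deg3 ![2, 1, r] = r + 3 := by simp [deg3]; omega
    rw [mem_lexT, hdeg, hb3]
    have : lexPos (r+3) 2 = 2 * (r+1) + 5 := hp2 (r+1)
    simp
    omega
  have hmj : ∀ j, ![2, 1, r] + Pi.single j 1 ∉ T' := by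
    intro j
    rw [mem_lexT, deg3_single]
    have hdeg : deg3 ![2, 1, r] + 1 = r + 4 := by simp [deg3]; omega
    rw [hdeg, hb4]
    have h2 : lexPos (r+4) 2 = 2 * (r+2) + 5 := hp2 (r+2)
    have h3 : lexPos (r+4) 3 = 3 * (r+2) + 6 := hp3 (r+2)
    fin_cases j <;> simp <;> intros <;> omega
  refine ⟨dpts a T, dpts a T', ?_, ?_, ?_, ?_⟩
  · intro i
    exact (dI_hilbert ha hT i).trans (hcT i)
  · intro i
    exact (dI_hilbert ha hT' i).trans (hcT' i)
  · refine ⟨X 0, isHomogeneous_X _ _, fun F hF => X0_nzd F hF, ?_⟩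
    refine wlp_cyl ha hT hN (fun α hα hd => ?_)
    rw [mem_cylT, deg3_single]
    have := (mem_cylT.1 hα).2
    refine ⟨by omega, ?_⟩
    simpa using this
  · intro L hL hnzd
    refine not_wlp ha hT' hN' ⟨_, hm⟩ hmj (r+2) (by simp [deg3]; omega) ?_ hL hnzd
    have hHm : Monotone H := monotone_nat_of_le_succ (fun n => by rw [hb]; omega)
    rw [hcT' (r+2+1), hcT' (r+2), hcT' (r+2+2), min_eq_left (hHm (by omega)), min_eq_left (hHm (by omega)),
      min_eq_left (hHm (by omega)), hb (r+2+1), hb (r+2)]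
    have e1 : b (r+2+1) = d := hb3
    have e2 : b (r+2+1+1) = d := hb4
    omega
end

section
/- Let k be an algebraically closed field and R = k[x_0,x_1,x_2,x_3]. Let H = {h_i} be a twice differentiable O-sequence with h_0 = 1, h_1 = 4, whose first difference ΔH is eventually constant with value d; let t be the least index with (ΔH)_t = d, set s = ⌊(d−1)/2⌋, and assume d > 3 and t ≤ s − 1. Let H̄ be the truncation of H at the value h_{s+1}, i.e., H̄(i) = min(h_i, h_{s+1}). Then there exist finite sets Z and Z' of points in P^3(k), both with Hilbert function H̄, such that the vanishing ideal I_Z has exactly d minimal generators in degree s + 2, while the vanishing ideal I_{Z'} has exactly d − 1 minimal generators in degree s + 2. In particular, there is no unique minimal set of graded Betti numbers among reduced zero-dimensional schemes with Hilbert function H̄. -/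
/-!
STATEMENT 13 (Theorem 4.1, Betti number part): with `H, b = ΔH, c = Δ²H, d, t,
s` as in the Basic Construction (`d > 3`, `t ≤ s − 1`, `s = ⌊(d−1)/2⌋`), and
`H̄` the truncation of `H` at the value `h_{s+1}`, there exist finite sets of
points `Z, Z'` in `P³(k)`, both with Hilbert function `H̄`, such that `I_Z`
has exactly `d` minimal generators in degree `s + 2` while `I_{Z'}` has
exactly `d − 1` minimal generators in degree `s + 2`.  (Consequently, there is
no unique minimal set of graded Betti numbers among reduced zero-dimensional
schemes with Hilbert function `H̄`.)
-/

open MvPolynomial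

/-- The degree-`j` graded piece `I_j` of an ideal `I`, as a `k`-subspace. -/
noncomputable def idealPiece {k : Type*} [Field k] {n : ℕ}
    (I : Ideal (MvPolynomial (Fin n) k)) (j : ℕ) :
    Submodule k (MvPolynomial (Fin n) k) :=
  (Submodule.restrictScalars k I) ⊓ MvPolynomial.homogeneousSubmodule (Fin n) k j

/-- The number of minimal generators of `I` in degree `j`, namely
`dim_k (I_j / R_1·I_{j−1})`. -/
noncomputable def minGensDeg {k : Type*} [Field k] {n : ℕ}
    (I : Ideal (MvPolynomial (Fin n) k)) (j : ℕ) : ℕ :=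
  Module.finrank k
    ((idealPiece I j) ⧸ (Submodule.comap (idealPiece I j).subtype
      (Submodule.span k {x | ∃ l ∈ MvPolynomial.homogeneousSubmodule (Fin n) k 1,
        ∃ g ∈ idealPiece I (j - 1), x = l * g})))

namespace PostBetti

open Finset

/-- Total degree of an exponent triple. -/
def dg (n : ℕ × ℕ × ℕ) : ℕ := n.1 + n.2.1 + n.2.2

/-- Triples of degree at most `j`. -/
def T (j : ℕ) : Finset (ℕ × ℕ × ℕ) :=
  (range (j + 1) ×ˢ range (j + 1) ×ˢ range (j + 1)).filter (fun n => dg n ≤ j)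

lemma mem_T {j : ℕ} {n : ℕ × ℕ × ℕ} : n ∈ T j ↔ dg n ≤ j := by
  obtain ⟨p, q, r⟩ := n
  unfold T
  rw [mem_filter]
  simp only [mem_product, mem_range, dg]
  omega

variable {k : Type} [Field k]

/-- Product of linear forms `x_i - a_l x_0` for `l < m`. -/
noncomputable def lp (a : ℕ → k) (i : Fin 4) (m : ℕ) : MvPolynomial (Fin 4) k :=
  ∏ l ∈ range m, (X i - C (a l) * X 0)

/-- The lifted monomial. -/
noncomputable def P (a : ℕ → k) (n : ℕ × ℕ × ℕ) : MvPolynomial (Fin 4) k :=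
  lp a 1 n.1 * lp a 2 n.2.1 * lp a 3 n.2.2

/-- Homogenization of the lifted monomial to degree `j`. -/
noncomputable def Q (a : ℕ → k) (j : ℕ) (n : ℕ × ℕ × ℕ) : MvPolynomial (Fin 4) k :=
  X 0 ^ (j - dg n) * P a n

/-- The lifted point. -/
def pt (a : ℕ → k) (m : ℕ × ℕ × ℕ) : Fin 4 → k := ![1, a m.1, a m.2.1, a m.2.2]

lemma pt_ne (a : ℕ → k) (m : ℕ × ℕ × ℕ) : pt a m ≠ 0 := by
  intro h
  have := congrFun h 0
  simp [pt] at this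

lemma lp_hom (a : ℕ → k) (i : Fin 4) (m : ℕ) : (lp a i m).IsHomogeneous m := by
  have h := MvPolynomial.IsHomogeneous.prod (range m) (fun l => X i - C (a l) * X 0)
    (fun _ => 1) (fun l _ => (isHomogeneous_X k i).sub
      (by simpa using (isHomogeneous_C (Fin 4) (a l)).mul (isHomogeneous_X k 0)))
  simpa [lp] using h

lemma Q_hom (a : ℕ → k) {j : ℕ} {n : ℕ × ℕ × ℕ} (h : dg n ≤ j) :
    (Q a j n).IsHomogeneous j := by
  have h1 := ((isHomogeneous_X k (0 : Fin 4)).pow (j - dg n)).mul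
    (((lp_hom a 1 n.1).mul (lp_hom a 2 n.2.1)).mul (lp_hom a 3 n.2.2))
  have e : 1 * (j - dg n) + (n.1 + n.2.1 + n.2.2) = j := by
    unfold dg at *; omega
  rw [e] at h1
  exact h1

lemma lp_succ (a : ℕ → k) (i : Fin 4) (m : ℕ) :
    X i * lp a i m = lp a i (m + 1) + C (a m) * X 0 * lp a i m := by
  simp only [lp, prod_range_succ]
  ring

lemma eval_Q (a : ℕ → k) (j : ℕ) (n m : ℕ × ℕ × ℕ) :
    eval (pt a m) (Q a j n) =
      (∏ l ∈ range n.1, (a m.1 - a l)) * (∏ l ∈ range n.2.1, (a m.2.1 - a l))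
        * (∏ l ∈ range n.2.2, (a m.2.2 - a l)) := by
  simp [Q, P, lp, pt, map_prod]

lemma prod_zero_iff {a : ℕ → k} (ha : Function.Injective a) (u v : ℕ) :
    (∏ l ∈ range v, (a u - a l)) = 0 ↔ u < v := by
  rw [prod_eq_zero_iff]
  constructor
  · rintro ⟨l, hl, h⟩
    have := ha (sub_eq_zero.mp h)
    subst this
    simpa using hl
  · intro h
    exact ⟨u, by simpa using h, sub_self _⟩

lemma eval_Q_zero_iff {a : ℕ → k} (ha : Function.Injective a) (j : ℕ) (n m : ℕ × ℕ × ℕ) :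
    eval (pt a m) (Q a j n) = 0 ↔ ¬ n ≤ m := by
  rw [eval_Q, mul_eq_zero, mul_eq_zero, prod_zero_iff ha, prod_zero_iff ha, prod_zero_iff ha,
    Prod.le_def, Prod.le_def]
  omega

lemma coeff_zero {a : ℕ → k} (ha : Function.Injective a) {j : ℕ}
    (c : ℕ × ℕ × ℕ → k) (M : Set (ℕ × ℕ × ℕ)) (hM : ∀ m ∈ M, ∀ n ≤ m, n ∈ M)
    (S : Finset (ℕ × ℕ × ℕ))
    (hf : ∀ m ∈ M, dg m ≤ j → eval (pt a m) (∑ n ∈ S, c n • Q a j n) = 0) :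
    ∀ N : ℕ, ∀ m ∈ M, dg m = N → m ∈ S → dg m ≤ j → c m = 0 := by
  intro N
  induction N using Nat.strong_induction_on with
  | _ N ih =>
    intro m hm hN hS hj
    have h := hf m hm hj
    rw [map_sum, Finset.sum_eq_single_of_mem m hS] at h
    · rw [smul_eval, mul_eq_zero] at h
      rcases h with h | h
      · exact h
      · exact absurd le_rfl ((eval_Q_zero_iff ha j m m).mp h)
    · intro n hn hne
      rw [smul_eval, mul_eq_zero]
      by_cases hle : n ≤ m
      · left
        have hlt : dg n < dg m := by
          obtain ⟨p, q, r⟩ := n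
          obtain ⟨p', q', r'⟩ := m
          simp only [Prod.le_def, dg, ne_eq, Prod.mk.injEq] at *
          omega
        exact ih (dg n) (by omega) n (hM m hm n hle) rfl hn (by omega)
      · right
        exact (eval_Q_zero_iff ha j n m).mpr hle

lemma Q_indep {a : ℕ → k} (ha : Function.Injective a) (j : ℕ) :
    LinearIndepOn k (Q a j) (T j : Set (ℕ × ℕ × ℕ)) := by
  rw [linearIndepOn_finset_iff]
  intro c hc m hm
  refine coeff_zero ha c Set.univ (by simp) (T j) ?_ (dg m) m trivial rfl hm (mem_T.mp hm)
  intro m _ _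
  rw [hc, map_zero]

lemma finrank_span_Q {a : ℕ → k} (ha : Function.Injective a) {j : ℕ}
    {S : Finset (ℕ × ℕ × ℕ)} (hS : S ⊆ T j) :
    Module.finrank k (Submodule.span k (Q a j '' (S : Set (ℕ × ℕ × ℕ)))) = S.card := by
  have h : LinearIndepOn k (Q a j) (S : Set (ℕ × ℕ × ℕ)) :=
    (Q_indep ha j).mono (by exact_mod_cast hS)
  have h2 := finrank_span_eq_card (R := k) (b := fun x : (S : Set (ℕ × ℕ × ℕ)) => Q a j x) h
  rw [Set.image_eq_range]
  simpa using h2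

/-- Multiplication rules. -/
lemma X0_mul_Q (a : ℕ → k) {j : ℕ} {n : ℕ × ℕ × ℕ} (h : dg n ≤ j) :
    X 0 * Q a j n = Q a (j + 1) n := by
  unfold Q
  rw [show j + 1 - dg n = (j - dg n) + 1 by omega]
  ring

lemma X1_mul_Q (a : ℕ → k) {j : ℕ} {n : ℕ × ℕ × ℕ} (h : dg n ≤ j) :
    X 1 * Q a j n = Q a (j + 1) (n.1 + 1, n.2.1, n.2.2) + a n.1 • Q a (j + 1) n := by
  unfold Q P
  rw [show j + 1 - dg n = (j - dg n) + 1 by omega,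
    show j + 1 - dg (n.1 + 1, n.2.1, n.2.2) = j - dg n by simp only [dg]; omega, smul_eq_C_mul]
  linear_combination (X 0 ^ (j - dg n) * lp a 2 n.2.1 * lp a 3 n.2.2) * lp_succ a 1 n.1

lemma X2_mul_Q (a : ℕ → k) {j : ℕ} {n : ℕ × ℕ × ℕ} (h : dg n ≤ j) :
    X 2 * Q a j n = Q a (j + 1) (n.1, n.2.1 + 1, n.2.2) + a n.2.1 • Q a (j + 1) n := by
  unfold Q P
  rw [show j + 1 - dg n = (j - dg n) + 1 by omega,
    show j + 1 - dg (n.1, n.2.1 + 1, n.2.2) = j - dg n by simp only [dg]; omega, smul_eq_C_mul]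
  linear_combination (X 0 ^ (j - dg n) * lp a 1 n.1 * lp a 3 n.2.2) * lp_succ a 2 n.2.1

lemma X3_mul_Q (a : ℕ → k) {j : ℕ} {n : ℕ × ℕ × ℕ} (h : dg n ≤ j) :
    X 3 * Q a j n = Q a (j + 1) (n.1, n.2.1, n.2.2 + 1) + a n.2.2 • Q a (j + 1) n := by
  unfold Q P
  rw [show j + 1 - dg n = (j - dg n) + 1 by omega,
    show j + 1 - dg (n.1, n.2.1, n.2.2 + 1) = j - dg n by simp only [dg]; omega, smul_eq_C_mul]
  linear_combination (X 0 ^ (j - dg n) * lp a 1 n.1 * lp a 2 n.2.1) * lp_succ a 3 n.2.2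

/-- `n` is obtained from something outside `M` by raising one exponent. -/
def Above (M : Finset (ℕ × ℕ × ℕ)) (n : ℕ × ℕ × ℕ) : Prop :=
  (∃ p, n.1 = p + 1 ∧ (p, n.2.1, n.2.2) ∉ M) ∨ (∃ q, n.2.1 = q + 1 ∧ (n.1, q, n.2.2) ∉ M) ∨
    (∃ r, n.2.2 = r + 1 ∧ (n.1, n.2.1, r) ∉ M)

lemma X_mul_mem (a : ℕ → k) {j : ℕ} {n : ℕ × ℕ × ℕ} (h : dg n ≤ j)
    (W : Submodule k (MvPolynomial (Fin 4) k)) (h0 : Q a (j + 1) n ∈ W)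
    (h1 : Q a (j + 1) (n.1 + 1, n.2.1, n.2.2) ∈ W)
    (h2 : Q a (j + 1) (n.1, n.2.1 + 1, n.2.2) ∈ W)
    (h3 : Q a (j + 1) (n.1, n.2.1, n.2.2 + 1) ∈ W) (i : Fin 4) : X i * Q a j n ∈ W := by
  fin_cases i
  · simpa [X0_mul_Q a h] using h0
  · simpa [X1_mul_Q a h] using W.add_mem h1 (W.smul_mem _ h0)
  · have := W.add_mem h2 (W.smul_mem (a n.2.1) h0)
    rw [← X2_mul_Q a h] at this
    exact this
  · have := W.add_mem h3 (W.smul_mem (a n.2.2) h0)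
    rw [← X3_mul_Q a h] at this
    exact this

/-- The `Q a j n` span the forms of degree `j`. -/
lemma hom_eq_span (a : ℕ → k) (j : ℕ) :
    homogeneousSubmodule (Fin 4) k j = Submodule.span k (Q a j '' (T j : Set (ℕ × ℕ × ℕ))) := by
  apply le_antisymm
  · induction j with
    | zero =>
      intro f hf
      rw [mem_homogeneousSubmodule] at hf
      have hC := (totalDegree_eq_zero_iff_eq_C (p := f)).mp (by
        have := hf.totalDegree_le; omega)
      rw [hC]
      have : C (coeff 0 f) = coeff 0 f • Q a 0 (0, 0, 0) := by
        simp [Q, P, lp, dg, smul_eq_C_mul]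
      rw [this]
      exact Submodule.smul_mem _ _ (Submodule.subset_span ⟨(0, 0, 0), by simp [T, dg], rfl⟩)
    | succ j ih =>
      have key : ∀ i : Fin 4, ∀ g ∈ homogeneousSubmodule (Fin 4) k j,
          X i * g ∈ Submodule.span k (Q a (j + 1) '' (T (j + 1) : Set (ℕ × ℕ × ℕ))) := by
        intro i g hg
        have hg' := ih hg
        clear hg
        induction hg' using Submodule.span_induction with
        | mem x hx =>
          obtain ⟨n, hn, rfl⟩ := hx
          have hn : dg n ≤ j := mem_T.mp (by exact_mod_cast hn)
          apply X_mul_mem a hn <;> refine Submodule.subset_span ⟨_, ?_, rfl⟩ <;>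
            rw [mem_coe, mem_T] <;> simp only [dg] at * <;> omega
        | zero => simp
        | add x y _ _ hx hy => rw [mul_add]; exact Submodule.add_mem _ hx hy
        | smul c x _ hx => rw [mul_smul_comm]; exact Submodule.smul_mem _ _ hx
      intro f hf
      rw [mem_homogeneousSubmodule] at hf
      rw [f.as_sum]
      refine Submodule.sum_mem _ (fun m hm => ?_)
      have hd := hf (mem_support_iff.mp hm)
      have hne : m ≠ 0 := by
        rintro rfl
        simp at hd
      obtain ⟨i, hi⟩ := Finsupp.ne_iff.mp hne
      have hle : Finsupp.single i 1 ≤ m := by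
        rw [Finsupp.single_le_iff]
        have : m i ≠ 0 := by simpa using hi
        omega
      have e : monomial m (coeff m f) = X i * monomial (m - Finsupp.single i 1) (coeff m f) := by
        rw [X, monomial_mul, add_tsub_cancel_of_le hle, one_mul]
      rw [e]
      apply key
      rw [mem_homogeneousSubmodule]
      apply isHomogeneous_monomial
      have h2 : m = Finsupp.single i 1 + (m - Finsupp.single i 1) :=
        (add_tsub_cancel_of_le hle).symm
      rw [h2] at hd
      have hw : ∀ x : Fin 4 →₀ ℕ, Finsupp.weight (1 : Fin 4 → ℕ) x = Finsupp.degree x :=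
        fun x => (DFunLike.congr_fun Finsupp.degree_eq_weight_one x).symm
      rw [hw] at hd
      simp only [map_add, Finsupp.degree_single] at hd
      omega
  · rw [Submodule.span_le]
    rintro _ ⟨n, hn, rfl⟩
    exact Q_hom a (mem_T.mp (by exact_mod_cast hn))

open Classical in
/-- The point set attached to `M`. -/
noncomputable def pts (a : ℕ → k) (M : Finset (ℕ × ℕ × ℕ)) :
    Finset (Projectivization k (Fin 4 → k)) :=
  M.image (fun m => Projectivization.mk k (pt a m) (pt_ne a m))

lemma mem_vanish (a : ℕ → k) (M : Finset (ℕ × ℕ × ℕ)) {j : ℕ} {f : MvPolynomial (Fin 4) k}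
    (hf : f.IsHomogeneous j) :
    f ∈ projVanishingIdeal k (pts a M : Set (Projectivization k (Fin 4 → k))) ↔
      ∀ m ∈ M, eval (pt a m) f = 0 := by
  simp only [projVanishingIdeal, Submodule.mem_iInf, RingHom.mem_ker]
  constructor
  · intro h m hm
    exact h _ (by
      simp only [pts, coe_image]
      exact ⟨m, by exact_mod_cast hm, rfl⟩) (pt a m) (pt_ne a m) rfl
  · intro h p hp v hv hvp
    simp only [pts, coe_image] at hp
    obtain ⟨m, hm, rfl⟩ := hp
    rw [Projectivization.mk_eq_mk_iff'] at hvp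
    obtain ⟨c, rfl⟩ := hvp
    have e : eval (c • pt a m) f = c ^ j * eval (pt a m) f := by
      rw [eval_eq', eval_eq', Finset.mul_sum]
      refine Finset.sum_congr rfl (fun x hx => ?_)
      have hd := hf (mem_support_iff.mp hx)
      have hw : Finsupp.weight (1 : Fin 4 → ℕ) x = ∑ i, x i := by
        rw [Finsupp.weight_apply, Finsupp.sum_fintype] <;> simp
      rw [hw] at hd
      simp only [Pi.smul_apply, smul_eq_mul, mul_pow, Finset.prod_mul_distrib,
        Finset.prod_pow_eq_pow_sum, hd]
      ring
    rw [e, h m (by exact_mod_cast hm), mul_zero]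

lemma exists_coeffs (q : ℕ × ℕ × ℕ → MvPolynomial (Fin 4) k) (S : Finset (ℕ × ℕ × ℕ))
    {f : MvPolynomial (Fin 4) k} (hf : f ∈ Submodule.span k (q '' (S : Set (ℕ × ℕ × ℕ)))) :
    ∃ c : ℕ × ℕ × ℕ → k, f = ∑ n ∈ S, c n • q n := by
  obtain ⟨l, hl, rfl⟩ := (Finsupp.mem_span_image_iff_linearCombination k).mp hf
  refine ⟨l, ?_⟩
  rw [Finsupp.linearCombination_apply]
  exact Finsupp.sum_of_support_subset _ (by exact_mod_cast (Finsupp.mem_supported k l).mp hl) _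
    (by simp)

lemma idealPiece_eq {a : ℕ → k} (ha : Function.Injective a) (M : Finset (ℕ × ℕ × ℕ))
    (hM : ∀ m ∈ M, ∀ n ≤ m, n ∈ M) (j : ℕ) :
    idealPiece (projVanishingIdeal k (pts a M : Set (Projectivization k (Fin 4 → k)))) j =
      Submodule.span k (Q a j '' ((T j \ M : Finset (ℕ × ℕ × ℕ)) : Set (ℕ × ℕ × ℕ))) := by
  apply le_antisymm
  · rintro f ⟨hf, hj⟩
    have hf : f ∈ projVanishingIdeal k (pts a M : Set (Projectivization k (Fin 4 → k))) := hf
    have hv := (mem_vanish a M ((mem_homogeneousSubmodule j f).mp hj)).mp hf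
    rw [SetLike.mem_coe, hom_eq_span a j] at hj
    obtain ⟨c, rfl⟩ := exists_coeffs (Q a j) (T j) hj
    refine Submodule.sum_mem _ (fun n hn => ?_)
    by_cases hnM : n ∈ M
    · have : c n = 0 := coeff_zero ha c (M : Set (ℕ × ℕ × ℕ)) (by exact_mod_cast hM) (T j)
        (fun m hm _ => hv m (by exact_mod_cast hm)) (dg n) n (by exact_mod_cast hnM) rfl hn
        (mem_T.mp hn)
      rw [this, zero_smul]
      exact Submodule.zero_mem _
    · exact Submodule.smul_mem _ _ (Submodule.subset_span ⟨n, by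
        rw [mem_coe, mem_sdiff]; exact ⟨hn, hnM⟩, rfl⟩)
  · rw [Submodule.span_le]
    rintro _ ⟨n, hn, rfl⟩
    rw [mem_coe, mem_sdiff, mem_T] at hn
    have hh := Q_hom a hn.1
    refine ⟨?_, hh⟩
    change Q a j n ∈ projVanishingIdeal k (pts a M : Set (Projectivization k (Fin 4 → k)))
    rw [mem_vanish a M hh]
    intro m hm
    rw [eval_Q_zero_iff ha]
    exact fun hle => hn.2 (hM m hm n hle)

theorem hilbert_pts {a : ℕ → k} (ha : Function.Injective a) (M : Finset (ℕ × ℕ × ℕ))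
    (hM : ∀ m ∈ M, ∀ n ≤ m, n ∈ M) (j : ℕ) :
    hilbertFn (projVanishingIdeal k (pts a M : Set (Projectivization k (Fin 4 → k)))) j =
      (M.filter (fun n => dg n ≤ j)).card := by
  set I := projVanishingIdeal k (pts a M : Set (Projectivization k (Fin 4 → k))) with hI
  have hA := finrank_span_Q ha (Finset.sdiff_subset (s := T j) (t := M))
  rw [← idealPiece_eq ha M hM j, ← hI] at hA
  have hR := finrank_span_Q ha (Finset.Subset.refl (T j))
  rw [← hom_eq_span a j] at hR
  have hfin : Module.Finite k (homogeneousSubmodule (Fin 4) k j) := by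
    rw [hom_eq_span a j]
    exact FiniteDimensional.span_of_finite k ((T j).finite_toSet.image _)
  let φ := (Ideal.Quotient.mkₐ k I).toLinearMap.domRestrict (homogeneousSubmodule (Fin 4) k j)
  have h1 := LinearMap.finrank_range_add_finrank_ker φ
  have h2 : LinearMap.range φ = quotPiece I j := by
    rw [LinearMap.range_domRestrict]; rfl
  have h3 : Module.finrank k (LinearMap.ker φ) = Module.finrank k (idealPiece I j) := by
    have : (LinearMap.ker φ).map (homogeneousSubmodule (Fin 4) k j).subtype = idealPiece I j := by
      ext f
      simp only [Submodule.mem_map, LinearMap.mem_ker, idealPiece, Submodule.mem_inf,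
        Submodule.restrictScalars_mem]
      constructor
      · rintro ⟨g, hg, rfl⟩
        exact ⟨Ideal.Quotient.eq_zero_iff_mem.mp hg, g.2⟩
      · rintro ⟨hf, hj⟩
        exact ⟨⟨f, hj⟩, Ideal.Quotient.eq_zero_iff_mem.mpr hf, rfl⟩
    rw [← this]
    exact (LinearEquiv.finrank_eq (Submodule.equivMapOfInjective _
      (Submodule.injective_subtype _) _))
  rw [h2, h3, hA, hR] at h1
  have h4 : (T j \ M).card + (T j ∩ M).card = (T j).card := Finset.card_sdiff_add_card_inter _ _
  have h5 : M.filter (fun n => dg n ≤ j) = T j ∩ M := by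
    ext n
    rw [mem_filter, mem_inter, mem_T, and_comm]
  unfold hilbertFn
  rw [h5]
  omega

open Classical in
theorem minGens_pts {a : ℕ → k} (ha : Function.Injective a) (M : Finset (ℕ × ℕ × ℕ))
    (hM : ∀ m ∈ M, ∀ n ≤ m, n ∈ M) (j : ℕ) (hj : ∀ m ∈ M, dg m ≤ j) :
    minGensDeg (projVanishingIdeal k (pts a M : Set (Projectivization k (Fin 4 → k)))) (j + 1) =
      ((T (j + 1)).filter (fun n => dg n = j + 1 ∧ ¬ Above M n)).card := by
  set I := projVanishingIdeal k (pts a M : Set (Projectivization k (Fin 4 → k))) with hI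
  set G : Finset (ℕ × ℕ × ℕ) :=
    (T (j + 1)).filter (fun n => n ∉ M ∧ (dg n ≤ j ∨ Above M n)) with hG
  have memG : ∀ n, n ∈ G ↔ dg n ≤ j + 1 ∧ n ∉ M ∧ (dg n ≤ j ∨ Above M n) := by
    intro n
    rw [hG, mem_filter, mem_T]
  have hGsub : G ⊆ T (j + 1) \ M := by
    intro n hn
    rw [memG] at hn
    rw [mem_sdiff, mem_T]
    exact ⟨hn.1, hn.2.1⟩
  have up : ∀ n ∉ M, ∀ m, n ≤ m → m ∉ M := fun n hn m hnm hm => hn (hM m hm n hnm)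
  have hW : Submodule.span k {x | ∃ l ∈ MvPolynomial.homogeneousSubmodule (Fin 4) k 1,
        ∃ g ∈ idealPiece I (j + 1 - 1), x = l * g} =
      Submodule.span k (Q a (j + 1) '' (G : Set (ℕ × ℕ × ℕ))) := by
    rw [Nat.add_sub_cancel, hI, idealPiece_eq ha M hM j]
    apply le_antisymm
    · rw [Submodule.span_le]
      have key : ∀ i : Fin 4, ∀ g ∈ Submodule.span k
          (Q a j '' ((T j \ M : Finset (ℕ × ℕ × ℕ)) : Set (ℕ × ℕ × ℕ))),
          X i * g ∈ Submodule.span k (Q a (j + 1) '' (G : Set (ℕ × ℕ × ℕ))) := by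
        intro i g hg
        induction hg using Submodule.span_induction with
        | mem x hx =>
          obtain ⟨n, hn, rfl⟩ := hx
          rw [mem_coe, mem_sdiff, mem_T] at hn
          obtain ⟨hn, hnM⟩ := hn
          apply X_mul_mem a hn <;> refine Submodule.subset_span ⟨_, ?_, rfl⟩ <;>
            rw [mem_coe, memG]
          · exact ⟨by omega, hnM, Or.inl hn⟩
          · exact ⟨by simp only [dg] at *; omega,
              up n hnM _ (by simp [Prod.le_def]),
              Or.inr (Or.inl ⟨n.1, rfl, hnM⟩)⟩
          · exact ⟨by simp only [dg] at *; omega,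
              up n hnM _ (by simp [Prod.le_def]),
              Or.inr (Or.inr (Or.inl ⟨n.2.1, rfl, hnM⟩))⟩
          · exact ⟨by simp only [dg] at *; omega,
              up n hnM _ (by simp [Prod.le_def]),
              Or.inr (Or.inr (Or.inr ⟨n.2.2, rfl, hnM⟩))⟩
        | zero => simp
        | add x y _ _ hx hy => rw [mul_add]; exact Submodule.add_mem _ hx hy
        | smul c x _ hx => rw [mul_smul_comm]; exact Submodule.smul_mem _ _ hx
      rintro _ ⟨l, hl, g, hg, rfl⟩
      rw [homogeneousSubmodule_one_eq_span_X] at hl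
      change l * g ∈ Submodule.span k (Q a (j + 1) '' (G : Set (ℕ × ℕ × ℕ)))
      induction hl using Submodule.span_induction with
      | mem x hx =>
        obtain ⟨i, rfl⟩ := hx
        exact key i g hg
      | zero => simp
      | add x y _ _ hx hy => rw [add_mul]; exact Submodule.add_mem _ hx hy
      | smul c x _ hx => rw [smul_mul_assoc]; exact Submodule.smul_mem _ _ hx
    · rw [Submodule.span_le]
      set W := Submodule.span k {x | ∃ l ∈ MvPolynomial.homogeneousSubmodule (Fin 4) k 1,
        ∃ g ∈ Submodule.span k
          (Q a j '' ((T j \ M : Finset (ℕ × ℕ × ℕ)) : Set (ℕ × ℕ × ℕ))), x = l * g} with hWdef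
      have hX : ∀ i : Fin 4, ∀ n, dg n ≤ j → n ∉ M → X i * Q a j n ∈ W := by
        intro i n hn hnM
        refine Submodule.subset_span ⟨X i, isHomogeneous_X k i, Q a j n,
          Submodule.subset_span ⟨n, ?_, rfl⟩, rfl⟩
        rw [mem_coe, mem_sdiff, mem_T]
        exact ⟨hn, hnM⟩
      have h0 : ∀ n, dg n ≤ j → n ∉ M → Q a (j + 1) n ∈ W := by
        intro n hn hnM
        rw [← X0_mul_Q a hn]
        exact hX 0 n hn hnM
      rintro _ ⟨n, hn, rfl⟩
      rw [mem_coe, memG] at hn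
      obtain ⟨hnj, hnM, hn⟩ := hn
      rcases hn with hn | ⟨p, hp, h⟩ | ⟨p, hp, h⟩ | ⟨p, hp, h⟩
      · exact h0 n hn hnM
      · have hd : dg (p, n.2.1, n.2.2) ≤ j := by simp only [dg] at *; omega
        have := W.sub_mem (hX 1 _ hd h) (W.smul_mem (a p) (h0 _ hd h))
        rw [X1_mul_Q a hd, add_sub_cancel_right, ← hp] at this
        exact this
      · have hd : dg (n.1, p, n.2.2) ≤ j := by simp only [dg] at *; omega
        have := W.sub_mem (hX 2 _ hd h) (W.smul_mem (a p) (h0 _ hd h))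
        rw [X2_mul_Q a hd, add_sub_cancel_right, ← hp] at this
        exact this
      · have hd : dg (n.1, n.2.1, p) ≤ j := by simp only [dg] at *; omega
        have := W.sub_mem (hX 3 _ hd h) (W.smul_mem (a p) (h0 _ hd h))
        rw [X3_mul_Q a hd, add_sub_cancel_right, ← hp] at this
        exact this
  unfold minGensDeg
  rw [hW]
  have hA := finrank_span_Q ha (Finset.sdiff_subset (s := T (j + 1)) (t := M))
  have hGr := finrank_span_Q ha (hGsub.trans Finset.sdiff_subset)
  have hle : Submodule.span k (Q a (j + 1) '' (G : Set (ℕ × ℕ × ℕ))) ≤ idealPiece I (j + 1) := by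
    rw [hI, idealPiece_eq ha M hM (j + 1)]
    exact Submodule.span_mono (Set.image_mono (by exact_mod_cast hGsub))
  have hfin : Module.Finite k (idealPiece I (j + 1)) := by
    rw [hI, idealPiece_eq ha M hM (j + 1)]
    exact FiniteDimensional.span_of_finite k ((T (j + 1) \ M).finite_toSet.image _)
  rw [← idealPiece_eq ha M hM (j + 1), ← hI] at hA
  have h1 := Submodule.finrank_quotient_add_finrank
    (Submodule.comap (idealPiece I (j + 1)).subtype
      (Submodule.span k (Q a (j + 1) '' (G : Set (ℕ × ℕ × ℕ)))))
  have h2 := (Submodule.comapSubtypeEquivOfLe hle).finrank_eq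
  rw [h2, hGr, hA] at h1
  have h3 : (T (j + 1)).filter (fun n => dg n = j + 1 ∧ ¬ Above M n) = (T (j + 1) \ M) \ G := by
    ext n
    rw [mem_filter, mem_sdiff, mem_sdiff, memG, mem_T]
    constructor
    · rintro ⟨h, h', h''⟩
      exact ⟨⟨h, fun hm => by have := hj n hm; omega⟩, fun hg => hg.2.2.elim (by omega) h''⟩
    · rintro ⟨⟨h, h'⟩, h''⟩
      refine ⟨h, ?_, fun hA => h'' ⟨h, h', Or.inr hA⟩⟩
      by_contra hne
      exact h'' ⟨h, h', Or.inl (by omega)⟩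
  rw [h3, Finset.card_sdiff_of_subset hGsub]
  omega

end PostBetti

namespace PostBetti

open Finset

/-! ### Combinatorics -/

lemma lower_of_step (M : Finset (ℕ × ℕ × ℕ))
    (h1 : ∀ p q r, (p + 1, q, r) ∈ M → (p, q, r) ∈ M)
    (h2 : ∀ p q r, (p, q + 1, r) ∈ M → (p, q, r) ∈ M)
    (h3 : ∀ p q r, (p, q, r + 1) ∈ M → (p, q, r) ∈ M) :
    ∀ m ∈ M, ∀ n ≤ m, n ∈ M := by
  have g1 : ∀ t p q r, (p + t, q, r) ∈ M → (p, q, r) ∈ M := by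
    intro t
    induction t with
    | zero => intro p q r h; exact h
    | succ t ih => intro p q r h; exact ih _ _ _ (h1 _ _ _ h)
  have g2 : ∀ t p q r, (p, q + t, r) ∈ M → (p, q, r) ∈ M := by
    intro t
    induction t with
    | zero => intro p q r h; exact h
    | succ t ih => intro p q r h; exact ih _ _ _ (h2 _ _ _ h)
  have g3 : ∀ t p q r, (p, q, r + t) ∈ M → (p, q, r) ∈ M := by
    intro t
    induction t with
    | zero => intro p q r h; exact h
    | succ t ih => intro p q r h; exact ih _ _ _ (h3 _ _ _ h)
  rintro ⟨p', q', r'⟩ hm ⟨p, q, r⟩ hle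
  simp only [Prod.le_def] at hle
  obtain ⟨x, rfl⟩ := Nat.exists_eq_add_of_le hle.1
  obtain ⟨y, rfl⟩ := Nat.exists_eq_add_of_le hle.2.1
  obtain ⟨z, rfl⟩ := Nat.exists_eq_add_of_le hle.2.2
  exact g1 _ _ _ _ (g2 _ _ _ _ (g3 _ _ _ _ hm))

lemma slice_card (S : Finset (ℕ × ℕ × ℕ)) (sh j : ℕ) (w : ℕ → ℕ) (hw : ∀ l, w l ≤ l + 1)
    (hS : ∀ x ∈ S, sh ≤ x.1 ∧ sh ≤ x.2.1)
    (hmem : ∀ p q r, (p + sh, q + sh, r) ∈ S ↔ p + q + r = j ∧ p < w (p + q)) :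
    S.card = ∑ l ∈ range (j + 1), w l := by
  have h : S.card = ((range (j + 1)).sigma (fun l => range (w l))).card := by
    refine Finset.card_nbij' (fun x => ⟨x.1 + x.2.1 - 2 * sh, x.1 - sh⟩)
      (fun y => (y.2 + sh, y.1 - y.2 + sh, j - y.1)) ?_ ?_ ?_ ?_
    · rintro ⟨p', q', r⟩ hx
      rw [mem_coe] at hx
      obtain ⟨hp, hq⟩ := hS _ hx
      simp only at hp hq
      obtain ⟨p, rfl⟩ := Nat.exists_eq_add_of_le' hp
      obtain ⟨q, rfl⟩ := Nat.exists_eq_add_of_le' hq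
      have := (hmem p q r).mp hx
      simp only [coe_sigma, Set.mem_sigma_iff, mem_coe, mem_range]
      rw [show p + sh + (q + sh) - 2 * sh = p + q by omega]
      omega
    · rintro ⟨l, u⟩ hx
      simp only [coe_sigma, Set.mem_sigma_iff, mem_coe, mem_range] at hx
      have := hw l
      rw [mem_coe]
      simp only
      rw [hmem, show u + (l - u) = l by omega]
      omega
    · rintro ⟨p', q', r⟩ hx
      rw [mem_coe] at hx
      obtain ⟨hp, hq⟩ := hS _ hx
      simp only at hp hq
      obtain ⟨p, rfl⟩ := Nat.exists_eq_add_of_le' hp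
      obtain ⟨q, rfl⟩ := Nat.exists_eq_add_of_le' hq
      have := (hmem p q r).mp hx
      simp only [Prod.mk.injEq]
      omega
    · rintro ⟨l, u⟩ hx
      simp only [coe_sigma, Set.mem_sigma_iff, mem_coe, mem_range] at hx
      have := hw l
      simp only [Sigma.mk.injEq, heq_eq_eq]
      omega
  rw [h, card_sigma]
  simp

lemma axis_card (S : Finset (ℕ × ℕ × ℕ)) (i u A v B : ℕ) (hv : 1 ≤ v) (hA : u + A ≤ i + 1)
    (hB : v + B ≤ i + 1)
    (hmem : ∀ p q r, (p, q, r) ∈ S ↔ p + q + r = i ∧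
      ((q = 0 ∧ u ≤ p ∧ p < u + A) ∨ (p = 0 ∧ v ≤ q ∧ q < v + B))) : S.card = A + B := by
  have h : S = (range A).image (fun p => (u + p, 0, i - (u + p))) ∪
      (range B).image (fun q => (0, v + q, i - (v + q))) := by
    ext ⟨p, q, r⟩
    rw [hmem, mem_union, mem_image, mem_image]
    simp only [mem_range, Prod.mk.injEq]
    constructor
    · rintro ⟨h, h' | h'⟩
      · left; exact ⟨p - u, by omega, by omega, by omega, by omega⟩
      · right; exact ⟨q - v, by omega, by omega, by omega, by omega⟩
    · rintro (⟨x, hx⟩ | ⟨x, hx⟩) <;> omega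
  rw [h, card_union_of_disjoint, card_image_of_injective, card_image_of_injective, card_range,
    card_range]
  · intro x y hxy
    simp only [Prod.mk.injEq] at hxy
    omega
  · intro x y hxy
    simp only [Prod.mk.injEq] at hxy
    omega
  · rw [Finset.disjoint_left]
    intro x hx hy
    rw [mem_image] at hx hy
    obtain ⟨y, _, rfl⟩ := hx
    obtain ⟨z, _, hz⟩ := hy
    simp only [Prod.mk.injEq] at hz
    omega

lemma sum_min (δ S : ℕ → ℕ) (hS0 : S 0 = 0) (hS : ∀ l, S (l + 1) = S l + δ l) (E L : ℕ) :
    ∑ l ∈ range L, min (δ l) (E - S l) = min E (S L) := by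
  induction L with
  | zero => simp [hS0]
  | succ L ih => rw [sum_range_succ, ih, hS]; omega

open Classical in
lemma first_construction (c : ℕ → ℕ) (s : ℕ) (hc1 : ∀ l, c l ≤ l + 1)
    (hc2 : ∀ l, c l ≤ l → c (l + 1) ≤ c l) (hc3 : ∀ l, s ≤ l → c l = 0) :
    ∃ M : Finset (ℕ × ℕ × ℕ), (∀ m ∈ M, ∀ n ≤ m, n ∈ M) ∧ (∀ m ∈ M, dg m ≤ s + 1) ∧
      (∀ i ≤ s + 1, (M.filter (fun n => dg n = i)).card = ∑ l ∈ range (i + 1), c l) ∧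
      ((T (s + 2)).filter (fun n => dg n = s + 2 ∧ ¬ Above M n)).card =
        ∑ l ∈ range (s + 3), c l := by
  have memM : ∀ p q r, (p, q, r) ∈ (T (s + 1)).filter (fun n => n.1 < c (n.1 + n.2.1)) ↔
      p + q + r ≤ s + 1 ∧ p < c (p + q) := by
    intro p q r
    rw [mem_filter, mem_T]
    rfl
  generalize (T (s + 1)).filter (fun n => n.1 < c (n.1 + n.2.1)) = M at memM
  have d1 : ∀ p q, p + 1 < c (p + 1 + q) → p < c (p + q) := by
    intro p q h
    have h1 := hc2 (p + q)
    rw [show p + 1 + q = p + q + 1 by omega] at h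
    omega
  have d2 : ∀ p q, p < c (p + (q + 1)) → p < c (p + q) := by
    intro p q h
    have h1 := hc2 (p + q)
    rw [show p + (q + 1) = p + q + 1 by omega] at h
    omega
  refine ⟨M, lower_of_step M ?_ ?_ ?_, ?_, ?_, ?_⟩
  · intro p q r h
    rw [memM] at *
    exact ⟨by omega, d1 _ _ h.2⟩
  · intro p q r h
    rw [memM] at *
    exact ⟨by omega, d2 _ _ h.2⟩
  · intro p q r h
    rw [memM] at *
    exact ⟨by omega, h.2⟩
  · rintro ⟨p, q, r⟩ h
    rw [memM] at h
    exact h.1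
  · intro i hi
    refine slice_card _ 0 i c hc1 (by simp) ?_
    intro p q r
    rw [mem_filter]
    simp only [add_zero, memM, dg]
    omega
  · refine slice_card _ 0 (s + 2) c hc1 (by simp) ?_
    intro p q r
    rw [mem_filter, mem_T]
    simp only [add_zero, Above, dg, memM]
    constructor
    · rintro ⟨h0, h1, h2⟩
      push Not at h2
      obtain ⟨ha, hb, hcc⟩ := h2
      refine ⟨h1, ?_⟩
      rcases r with _ | r
      · exfalso
        rcases p with _ | p
        · rcases q with _ | q
          · omega
          · have := (hb q rfl).2
            rw [hc3 _ (by omega)] at this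
            omega
        · have := (ha p rfl).2
          rw [hc3 _ (by omega)] at this
          omega
      · exact (hcc r rfl).2
    · rintro ⟨h0, h1⟩
      refine ⟨by omega, h0, ?_⟩
      push Not
      refine ⟨?_, ?_, ?_⟩
      · rintro p' rfl
        exact ⟨by omega, d1 _ _ h1⟩
      · rintro q' rfl
        exact ⟨by omega, d2 _ _ h1⟩
      · rintro r' rfl
        exact ⟨by omega, h1⟩

open Classical in
lemma second_construction (δ S e : ℕ → ℕ) (s ε : ℕ) (hs : 3 ≤ s) (hε : ε ≤ 1)
    (hδ0 : δ 0 = 1) (hδ1 : ∀ l, δ l ≤ l + 1) (hδ2 : ∀ l, δ l ≤ l → δ (l + 1) ≤ δ l)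
    (hS0 : S 0 = 0) (hS : ∀ l, S (l + 1) = S l + δ l)
    (he : ∀ j, min (e (j + 1)) (S (j + 1)) ≤ e j) (heS : ∀ j, e j ≤ S (j + 1))
    (he0 : ∀ j, s ≤ j → e j = 0) (he1 : e (s - 1) = ε) :
    ∃ M : Finset (ℕ × ℕ × ℕ), (∀ m ∈ M, ∀ n ≤ m, n ∈ M) ∧ (∀ m ∈ M, dg m ≤ s + 1) ∧
      (∀ i ≤ 1, (M.filter (fun n => dg n = i)).card = 2 * i + 1) ∧
      (∀ i, i + 2 ≤ s → (M.filter (fun n => dg n = i + 2)).card = 2 * (i + 2) + 1 + e i) ∧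
      (M.filter (fun n => dg n = s + 1)).card = 2 * s + 1 + ε ∧
      ((T (s + 2)).filter (fun n => dg n = s + 2 ∧ ¬ Above M n)).card = 2 * s + ε := by
  have hSm : Monotone S := monotone_nat_of_le_succ (fun l => by rw [hS]; omega)
  obtain ⟨M, memX, memZ⟩ : ∃ M : Finset (ℕ × ℕ × ℕ),
      (∀ a b r, (a + 1, b + 1, r) ∈ M ↔ a < δ (a + b) ∧ S (a + b) + a < e (a + b + r)) ∧
      (∀ p q r, p = 0 ∨ q = 0 → ((p, q, r) ∈ M ↔
        (p + q + r ≤ s ∨ (p + q + r = s + 1 ∧ r ≠ s + 1 ∧ p ≠ s + 1)))) := by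
    refine ⟨(T (s + 1)).filter (fun n => if n.1 = 0 ∨ n.2.1 = 0 then
      (n.1 + n.2.1 + n.2.2 ≤ s ∨ (n.1 + n.2.1 + n.2.2 = s + 1 ∧ n.2.2 ≠ s + 1 ∧ n.1 ≠ s + 1))
      else (n.1 - 1 < δ (n.1 - 1 + (n.2.1 - 1)) ∧ S (n.1 - 1 + (n.2.1 - 1)) + (n.1 - 1) <
        e (n.1 - 1 + (n.2.1 - 1) + n.2.2))), ?_, ?_⟩
    · intro a b r
      rw [mem_filter, mem_T]
      simp only [dg, Nat.add_eq_zero_iff, one_ne_zero, and_false, or_self, if_false,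
        Nat.add_sub_cancel]
      constructor
      · exact fun h => h.2
      · intro h
        refine ⟨?_, h⟩
        by_contra hcon
        have := he0 (a + b + r) (by omega)
        omega
    · intro p q r h
      rw [mem_filter, mem_T]
      simp only [h, if_true, dg]
      omega
  have hj : ∀ a b r, (a + 1, b + 1, r) ∈ M → a + b + r < s := by
    intro a b r h
    rw [memX] at h
    by_contra hcon
    have := he0 (a + b + r) (by omega)
    omega
  have stepz : ∀ a l r, a < δ l → S l + a < e (l + (r + 1)) → S l + a < e (l + r) := by
    intro a l r h1 h2
    have h3 := he (l + r)
    have h4 := hSm (show l + 1 ≤ l + r + 1 by omega)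
    have h5 := hS l
    rw [show l + (r + 1) = l + r + 1 by omega] at h2
    omega
  have stepxy : ∀ a a' l r, a' < δ l → S (l + 1) + a < e (l + 1 + r) → S l + a' < e (l + r) := by
    intro a a' l r h1 h2
    have h3 := he (l + r)
    have h4 := hSm (show l + 1 ≤ l + r + 1 by omega)
    have h5 := hS l
    rw [show l + 1 + r = l + r + 1 by omega] at h2
    omega
  have hxy1 : ∀ a b r, (a + 1, b + 1, r + 1) ∈ M → (a + 1, b + 1, r) ∈ M := by
    intro a b r h
    rw [memX] at *
    exact ⟨h.1, stepz _ _ _ h.1 h.2⟩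
  have top : ∀ a b r, a + b + r + 1 = s → ((a + 1, b + 1, r) ∈ M ↔ ε = 1 ∧ a = 0 ∧ b = 0) := by
    intro a b r h
    rw [memX, show a + b + r = s - 1 by omega, he1]
    constructor
    · rintro ⟨h1, h2⟩
      rcases Nat.eq_zero_or_pos (a + b) with h0 | h0
      · omega
      · have h4 := hSm (show 1 ≤ a + b by omega)
        have h5 := hS 0
        rw [zero_add] at h5
        omega
    · rintro ⟨h1, rfl, rfl⟩
      simp only [add_zero, hδ0, hS0]
      omega
  have lower : ∀ m ∈ M, ∀ n ≤ m, n ∈ M := by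
    refine lower_of_step M ?_ ?_ ?_
    · intro p q r h
      rcases q with _ | b
      · rw [memZ _ _ _ (Or.inr rfl)] at *
        omega
      rcases p with _ | a
      · have := hj _ _ _ h
        rw [memZ _ _ _ (Or.inl rfl)]
        omega
      rw [memX] at *
      have h1 := hδ2 (a + b)
      rw [show a + 1 + b = a + b + 1 by omega] at h
      have h2 : a < δ (a + b) := by omega
      exact ⟨h2, stepxy _ _ _ _ h2 h.2⟩
    · intro p q r h
      rcases p with _ | a
      · rw [memZ _ _ _ (Or.inl rfl)] at *
        omega
      rcases q with _ | b
      · have := hj _ _ _ h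
        rw [memZ _ _ _ (Or.inr rfl)]
        omega
      rw [memX] at *
      have h1 := hδ2 (a + b)
      rw [show a + (b + 1) = a + b + 1 by omega] at h
      have h2 : a < δ (a + b) := by omega
      exact ⟨h2, stepxy _ _ _ _ h2 h.2⟩
    · intro p q r h
      rcases p with _ | a
      · rw [memZ _ _ _ (Or.inl rfl)] at *
        omega
      rcases q with _ | b
      · rw [memZ _ _ _ (Or.inr rfl)] at *
        omega
      exact hxy1 _ _ _ h
  have split : ∀ F : Finset (ℕ × ℕ × ℕ), F.card =
      (F.filter (fun n => 1 ≤ n.1 ∧ 1 ≤ n.2.1)).card +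
      (F.filter (fun n => ¬ (1 ≤ n.1 ∧ 1 ≤ n.2.1))).card := by
    intro F
    exact (Finset.card_filter_add_card_filter_not _).symm
  have xyslice : ∀ j, ((M.filter (fun n => dg n = j + 2)).filter
      (fun n => 1 ≤ n.1 ∧ 1 ≤ n.2.1)).card = e j := by
    intro j
    rw [slice_card _ 1 j (fun l => min (δ l) (e j - S l)) (fun l => (min_le_left _ _).trans (hδ1 l)),
      sum_min δ S hS0 hS, min_eq_left (heS j)]
    · intro x hx
      rw [mem_filter] at hx
      exact hx.2
    · intro p q r
      rw [mem_filter, mem_filter, memX]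
      simp only [dg]
      constructor
      · rintro ⟨⟨⟨h1, h2⟩, h3⟩, h4⟩
        have : p + q + r = j := by omega
        rw [this] at h2
        refine ⟨this, ?_⟩
        omega
      · rintro ⟨h1, h2⟩
        rw [h1]
        omega
  have zslice : ∀ i ≤ s, ((M.filter (fun n => dg n = i)).filter
      (fun n => ¬ (1 ≤ n.1 ∧ 1 ≤ n.2.1))).card = 2 * i + 1 := by
    intro i hi
    rw [axis_card _ i 0 (i + 1) 1 i (by omega) (by omega) (by omega)]
    · omega
    · intro p q r
      rw [mem_filter, mem_filter]
      simp only [dg]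
      by_cases h : p = 0 ∨ q = 0
      · rw [memZ _ _ _ h]
        omega
      · omega
  refine ⟨M, lower, ?_, ?_, ?_, ?_, ?_⟩
  · rintro ⟨p, q, r⟩ h
    simp only [dg]
    by_cases h0 : p = 0 ∨ q = 0
    · rw [memZ _ _ _ h0] at h
      omega
    · rcases p with _ | a
      · omega
      rcases q with _ | b
      · omega
      have := hj _ _ _ h
      omega
  · intro i hi
    rw [split, zslice i (by omega)]
    have : (M.filter (fun n => dg n = i)).filter (fun n => 1 ≤ n.1 ∧ 1 ≤ n.2.1) = ∅ := by
      rw [Finset.filter_eq_empty_iff]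
      intro x hx
      rw [mem_filter] at hx
      have := hx.2
      simp only [dg] at this
      omega
    rw [this, card_empty]
    omega
  · intro i hi
    rw [split, xyslice, zslice _ hi]
    omega
  · rw [split, show s + 1 = (s - 1) + 2 by omega, xyslice, he1]
    rw [axis_card _ (s + 1) 1 s 1 (s + 1) (by omega) (by omega) (by omega)]
    · omega
    · intro p q r
      rw [mem_filter, mem_filter]
      simp only [dg]
      by_cases h : p = 0 ∨ q = 0
      · rw [memZ _ _ _ h]
        omega
      · omega
  · rw [split]
    rw [slice_card _ 1 s (fun l => if l = 0 then ε else 0)]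
    · rw [axis_card _ (s + 2) 2 (s - 1) 2 (s + 1) (by omega) (by omega) (by omega)]
      · rw [Finset.sum_ite_eq' (range (s + 1)) 0 (fun _ => ε), if_pos (by simp)]
        omega
      · intro p q r
        rw [mem_filter, mem_filter, mem_T]
        simp only [dg, Above]
        push Not
        by_cases h : p = 0 ∨ q = 0
        · constructor
          · rintro ⟨⟨h1, h2, h3, h4, h5⟩, h6⟩
            refine ⟨h2, ?_⟩
            rcases h with rfl | rfl
            · right
              refine ⟨rfl, ?_, by omega⟩
              rcases q with _ | q
              · have := (memZ _ _ _ (Or.inl rfl)).mp (h5 (s + 1) (by omega))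
                omega
              · have := (memZ _ _ _ (Or.inl rfl)).mp (h4 q rfl)
                omega
            · left
              refine ⟨rfl, ?_⟩
              rcases p with _ | p
              · have := (memZ _ _ _ (Or.inl rfl)).mp (h5 (s + 1) (by omega))
                omega
              · have h7 := (memZ _ _ _ (Or.inr rfl)).mp (h3 p rfl)
                rcases r with _ | r
                · omega
                · have := (memZ _ _ _ (Or.inr rfl)).mp (h5 r rfl)
                  omega
          · rintro ⟨h2, h3⟩
            refine ⟨⟨by omega, h2, ?_, ?_, ?_⟩, by omega⟩
            · rintro p' rfl
              have hq : q = 0 := by omega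
              rw [memZ _ _ _ (Or.inr hq)]
              omega
            · rintro q' rfl
              have hq : p = 0 := by omega
              rw [memZ _ _ _ (Or.inl hq)]
              omega
            · rintro r' rfl
              rw [memZ _ _ _ h]
              omega
        · omega
    · intro l
      split_ifs <;> omega
    · intro x hx
      rw [mem_filter] at hx
      exact hx.2
    · intro a b r
      rw [mem_filter, mem_filter, mem_T]
      simp only [dg, Above]
      push Not
      constructor
      · rintro ⟨⟨h1, h2, h3, h4, h5⟩, h6⟩
        refine ⟨by omega, ?_⟩
        rcases r with _ | r
        · rcases a with _ | a
          · rcases b with _ | b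
            · omega
            · have := (top 0 b 0 (by omega)).mp (h4 (b + 1) rfl)
              omega
          · have := (top a b 0 (by omega)).mp (h3 (a + 1) rfl)
            omega
        · have := (top a b r (by omega)).mp (h5 r rfl)
          rw [if_pos (by omega)]
          omega
      · rintro ⟨h1, h2⟩
        split_ifs at h2 with h0
        · have ha : a = 0 := by omega
          have hb : b = 0 := by omega
          subst ha hb
          refine ⟨⟨by omega, by omega, ?_, ?_, ?_⟩, by omega⟩
          · intro p hp
            rw [memZ _ _ _ (Or.inl (by omega))]
            omega
          · intro p hp
            rw [memZ _ _ _ (Or.inr (by omega))]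
            omega
          · intro p hp
            exact (top 0 0 p (by omega)).mpr (by omega)
        · omega

/-! ### Macaulay growth -/

lemma binomExpTop_eq {a i m : ℕ} (hm : m ≤ a + i) (h1 : m.choose i ≤ a)
    (h2 : a < (m + 1).choose i) : binomExpTop a i = m := by
  unfold binomExpTop
  rw [Nat.findGreatest_eq_iff]
  refine ⟨hm, fun _ => h1, ?_⟩
  intro n hn _ h
  have := Nat.choose_le_choose i (show m + 1 ≤ n by omega)
  omega

lemma grow_zero (i : ℕ) : macaulayGrow i 0 = 0 := by
  cases i <;> simp [macaulayGrow]

lemma grow_le (i : ℕ) : ∀ a ≤ i, macaulayGrow i a = a := by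
  induction i with
  | zero => intro a ha; simp [macaulayGrow]; omega
  | succ i ih =>
    intro a ha
    rcases Nat.eq_zero_or_pos a with rfl | h0
    · exact grow_zero _
    · have ht : binomExpTop a (i + 1) = i + 1 :=
        binomExpTop_eq (by omega) (by simp; omega) (by simp; omega)
      rw [macaulayGrow, if_neg (by omega), ht]
      simp only [Nat.choose_self]
      rw [ih (a - 1) (by omega)]
      omega

lemma grow_succ (i : ℕ) (hi : 1 ≤ i) : macaulayGrow i (i + 1) = i + 2 := by
  obtain ⟨i, rfl⟩ := Nat.exists_eq_add_of_le' hi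
  have ht : binomExpTop (i + 1 + 1) (i + 1) = i + 2 := by
    refine binomExpTop_eq (by omega) ?_ ?_
    · rw [Nat.choose_succ_self_right]
    · rw [Nat.choose_succ_succ, Nat.choose_succ_self_right]
      have := Nat.choose_pos (show i ≤ i + 2 by omega)
      have h2 : (i + 2).choose i = (i + 2).choose 2 := by
        rw [← Nat.choose_symm_add]
      rw [h2, Nat.choose_succ_succ]
      simp
  rw [macaulayGrow, if_neg (by omega), ht, Nat.choose_succ_self_right, Nat.choose_succ_self_right]
  simp [grow_zero]

end PostBetti

namespace PostBetti

open Finset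

lemma count_le (M : Finset (ℕ × ℕ × ℕ)) (H b : ℕ → ℕ) (s : ℕ) (h0 : b 0 = H 0)
    (hb : ∀ i : ℕ, H (i + 1) = H i + b (i + 1)) (hdeg : ∀ m ∈ M, dg m ≤ s + 1)
    (hsl : ∀ i ≤ s + 1, (M.filter (fun n => dg n = i)).card = b i) (i : ℕ) :
    (M.filter (fun n => dg n ≤ i)).card = min (H i) (H (s + 1)) := by
  have hmono : Monotone H := monotone_nat_of_le_succ (fun l => by rw [hb]; omega)
  have key : ∀ i ≤ s + 1, (M.filter (fun n => dg n ≤ i)).card = H i := by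
    intro i
    induction i with
    | zero =>
      intro hi
      rw [← h0, ← hsl 0 hi]
      simp
    | succ i ih =>
      intro hi
      rw [hb, ← ih (by omega), ← hsl (i + 1) hi, ← card_union_of_disjoint]
      · congr 1
        ext n
        rw [mem_union, mem_filter, mem_filter, mem_filter, ← and_or_left]
        refine and_congr_right (fun _ => ?_)
        omega
      · rw [Finset.disjoint_left]
        intro n h1 h2
        rw [mem_filter] at h1 h2
        omega
  rcases le_total i (s + 1) with hi | hi
  · rw [key i hi, min_eq_left (hmono hi)]
  · rw [min_eq_right (hmono hi), ← key (s + 1) le_rfl]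
    congr 1
    refine Finset.filter_congr (fun n hn => ?_)
    have := hdeg n hn
    omega

end PostBetti

theorem reducible_postulation_scheme_betti
    (k : Type) [Field k] [IsAlgClosed k]
    (H b c : ℕ → ℕ) (d t s : ℕ)
    (hH0 : H 0 = 1) (hH1 : H 1 = 4)
    (hb0 : b 0 = H 0) (hb : ∀ i : ℕ, H (i + 1) = H i + b (i + 1))
    (hc0 : c 0 = b 0) (hc : ∀ i : ℕ, b (i + 1) = b i + c (i + 1))
    (hOH : IsOSequence H) (hOb : IsOSequence b) (hOc : IsOSequence c)
    (hev : ∃ N : ℕ, ∀ i : ℕ, N ≤ i → b i = d)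
    (htd : b t = d) (htmin : ∀ i : ℕ, i < t → b i ≠ d)
    (hs : s = (d - 1) / 2)
    (hd : 3 < d) (hts : t ≤ s - 1) :
    ∃ Z Z' : Finset (Projectivization k (Fin 4 → k)),
      (∀ i : ℕ, hilbertFn (projVanishingIdeal k (Z : Set (Projectivization k (Fin 4 → k)))) i
          = min (H i) (H (s + 1))) ∧
      (∀ i : ℕ, hilbertFn (projVanishingIdeal k (Z' : Set (Projectivization k (Fin 4 → k)))) i
          = min (H i) (H (s + 1))) ∧
      minGensDeg (projVanishingIdeal k (Z : Set (Projectivization k (Fin 4 → k)))) (s + 2)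
          = d ∧
      minGensDeg (projVanishingIdeal k (Z' : Set (Projectivization k (Fin 4 → k)))) (s + 2)
          = d - 1 := by
  obtain ⟨a, ha⟩ : ∃ a : ℕ → k, Function.Injective a :=
    ⟨Infinite.natEmbedding k, (Infinite.natEmbedding k).injective⟩
  have hb1 : b 1 = 3 := by have := hb 0; simp only [zero_add] at this; omega
  have hc1 : c 1 = 2 := by have := hc 0; simp only [zero_add] at this; omega
  have hcle : ∀ l, c l ≤ l + 1 := by
    intro l
    induction l with
    | zero => omega
    | succ l ih =>
      rcases Nat.eq_zero_or_pos l with rfl | h0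
      · simp only [zero_add]; omega
      have h1 := hOc.2 l h0
      by_cases h2 : c l ≤ l
      · rw [PostBetti.grow_le l _ h2] at h1
        omega
      · rw [show c l = l + 1 by omega, PostBetti.grow_succ l h0] at h1
        exact h1
  have hcni : ∀ l, c l ≤ l → c (l + 1) ≤ c l := by
    intro l h2
    rcases Nat.eq_zero_or_pos l with rfl | h0
    · omega
    have h1 := hOc.2 l h0
    rwa [PostBetti.grow_le l _ h2] at h1
  have hbm : Monotone b := monotone_nat_of_le_succ (fun l => by rw [hc]; omega)
  have hbt : ∀ i, t ≤ i → b i = d := by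
    intro i hi
    obtain ⟨N, hN⟩ := hev
    have h1 := hbm hi
    have h2 := hbm (le_max_left i N)
    have h3 := hN _ (le_max_right i N)
    omega
  have hct : ∀ i, t < i → c i = 0 := by
    intro i hi
    obtain ⟨i, rfl⟩ := Nat.exists_eq_add_of_lt hi
    have h1 := hc (t + i)
    rw [hbt _ (by omega), hbt _ (by omega)] at h1
    omega
  have hsum : ∀ i, ∑ l ∈ Finset.range (i + 1), c l = b i := by
    intro i
    induction i with
    | zero => simpa using hc0
    | succ i ih => rw [Finset.sum_range_succ, ih, hc]
  -- once `c` is at most `1` (resp. `2`), it stays so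
  have hstay : ∀ v, ∀ i, v ≤ i → c i ≤ v → ∀ m, c (i + m) ≤ v := by
    intro v i hi h m
    induction m with
    | zero => exact h
    | succ m ih =>
      have := hcni (i + m) (by omega)
      rw [← add_assoc]
      omega
  have hs1 : 1 ≤ s := by omega
  have hc2 : c 2 = 3 := by
    by_contra hne
    have h2 : c 2 ≤ 2 := by have := hcle 2; omega
    have hbb : ∀ i, b i ≤ 2 * i + 1 := by
      intro i
      induction i with
      | zero => omega
      | succ i ih =>
        have h3 := hc i
        have h4 : c (i + 1) ≤ 2 := by
          rcases Nat.eq_zero_or_pos i with rfl | h0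
          · simp only [zero_add]; omega
          · obtain ⟨m, rfl⟩ := Nat.exists_eq_add_of_le h0
            have := hstay 2 2 le_rfl h2 m
            rw [show 0 + 1 + m + 1 = 2 + m by omega]
            exact this
        omega
    have := hbb t
    omega
  have ht2 : 2 ≤ t := by
    by_contra h
    have := hct 2 (by omega)
    omega
  obtain ⟨ε, hε, hdε⟩ : ∃ ε, ε ≤ 1 ∧ d = 2 * s + 1 + ε := ⟨d - (2 * s + 1), by omega, by omega⟩
  -- first set
  obtain ⟨M, hM1, hM2, hM3, hM4⟩ := PostBetti.first_construction c s hcle hcni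
    (fun l hl => hct l (by omega))
  -- second set
  let δ : ℕ → ℕ := fun l => c (l + 2) - 2
  let S : ℕ → ℕ := fun l => ∑ i ∈ Finset.range l, δ i
  let e : ℕ → ℕ := fun j => if j + 2 ≤ s then b (j + 2) - (2 * j + 5) else
    if j + 1 = s then ε else 0
  have hδ : ∀ l, δ l = c (l + 2) - 2 := fun _ => rfl
  have hS0 : S 0 = 0 := by simp [S]
  have hSs : ∀ l, S (l + 1) = S l + δ l := fun l => Finset.sum_range_succ _ _
  have hel : ∀ j, j + 2 ≤ s → e j = b (j + 2) - (2 * j + 5) := fun j hj => if_pos hj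
  have het : ∀ j, j + 1 = s → e j = ε := fun j hj => by
    simp only [e]; rw [if_neg (by omega), if_pos hj]
  have hez : ∀ j, s ≤ j → e j = 0 := fun j hj => by
    simp only [e]; rw [if_neg (by omega), if_neg (by omega)]
  have hbS : ∀ j, b (j + 2) ≤ 2 * j + 5 + S (j + 1) := by
    intro j
    induction j with
    | zero =>
      have h1 := hc 1
      have h2 := hSs 0
      have h3 := hδ 0
      simp only [zero_add, one_add_one_eq_two] at *
      omega
    | succ j ih =>
      have h1 := hc (j + 2)
      have h2 := hSs (j + 1)
      have h3 := hδ (j + 1)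
      rw [show j + 1 + 2 = j + 2 + 1 by omega] at *
      omega
  -- either still in the growth phase, or `c` is at most one from here on
  have hphase : ∀ j, b (j + 2) = 2 * j + 5 + S (j + 1) ∨ ∀ m, c (j + 2 + m) ≤ 1 := by
    intro j
    induction j with
    | zero =>
      left
      have h1 := hc 1
      have h2 := hSs 0
      have h3 := hδ 0
      simp only [zero_add, one_add_one_eq_two] at *
      omega
    | succ j ih =>
      rcases ih with ih | ih
      · by_cases h : c (j + 3) ≤ 1
        · right
          exact hstay 1 (j + 3) (by omega) h
        · left
          have h1 := hc (j + 2)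
          have h2 := hSs (j + 1)
          have h3 := hδ (j + 1)
          rw [show j + 1 + 2 = j + 2 + 1 by omega] at *
          rw [show j + 3 = j + 2 + 1 by omega] at h
          omega
      · right
        intro m
        have := ih (m + 1)
        rwa [show j + 1 + 2 + m = j + 2 + (m + 1) by omega]
  have hblow : ∀ j, j + 2 ≤ s → 2 * j + 5 ≤ b (j + 2) := by
    intro j hj
    rcases hphase j with h | h
    · omega
    · have hg : ∀ m, b (j + 2 + m) ≤ b (j + 2) + m := by
        intro m
        induction m with
        | zero => simp
        | succ m ih =>
          have h1 := hc (j + 2 + m)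
          have h2 := h (m + 1)
          rw [← add_assoc] at *
          omega
      have h1 := hg (s - (j + 2))
      rw [show j + 2 + (s - (j + 2)) = s by omega, hbt s (by omega)] at h1
      omega
  have hbs : b s = d := hbt s (by omega)
  have hSm : Monotone S := monotone_nat_of_le_succ (fun l => by rw [hSs]; omega)
  have hes2 : e (s - 2) = ε := by
    rw [hel _ (by omega), show s - 2 + 2 = s by omega, hbs]
    omega
  obtain ⟨M', hM'1, hM'2, hM'3, hM'4, hM'5, hM'6⟩ :=
    PostBetti.second_construction δ S e s ε (by omega) hε (by rw [hδ, zero_add, hc2])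
      (fun l => by have := hcle (l + 2); rw [hδ]; omega)
      (fun l => by
        have := hcni (l + 2)
        rw [hδ, hδ, show l + 1 + 2 = l + 2 + 1 by omega]; omega)
      hS0 hSs
      (fun j => by
        by_cases h1 : j + 1 + 2 ≤ s
        · rw [hel _ h1, hel _ (by omega)]
          rcases hphase j with h | h
          · omega
          · have h2 := h 1
            have h3 := hc (j + 2)
            rw [show j + 1 + 2 = j + 2 + 1 by omega]
            omega
        · by_cases h2 : j + 2 = s
          · rw [het (j + 1) (by omega), show j = s - 2 by omega, hes2]
            exact min_le_left _ _
          · rw [hez (j + 1) (by omega)]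
            simp)
      (fun j => by
        by_cases h1 : j + 2 ≤ s
        · rw [hel _ h1]
          have := hbS j
          omega
        · by_cases h2 : j + 1 = s
          · rw [het _ h2, ← hes2, hel _ (by omega)]
            have h3 := hbS (s - 2)
            have h4 := hSm (show s - 2 + 1 ≤ j + 1 by omega)
            omega
          · rw [hez _ (by omega)]
            omega)
      hez (het _ (by omega))
  refine ⟨PostBetti.pts a M, PostBetti.pts a M', ?_, ?_, ?_, ?_⟩
  · intro i
    rw [PostBetti.hilbert_pts ha M hM1]
    exact PostBetti.count_le M H b s hb0 hb hM2 (fun i hi => by rw [hM3 i hi, hsum]) i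
  · intro i
    rw [PostBetti.hilbert_pts ha M' hM'1]
    refine PostBetti.count_le M' H b s hb0 hb hM'2 (fun i hi => ?_) i
    rcases Nat.lt_or_ge i 2 with h2 | h2
    · rw [hM'3 i (by omega)]
      interval_cases i <;> omega
    · rcases Nat.lt_or_ge s i with h3 | h3
      · obtain rfl : i = s + 1 := by omega
        rw [hM'5, hbt _ (by omega)]
        omega
      · obtain ⟨i, rfl⟩ := Nat.exists_eq_add_of_le' h2
        rw [hM'4 i h3, hel i h3]
        have := hblow i h3
        omega
  · rw [PostBetti.minGens_pts ha M hM1 (s + 1) hM2]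
    rw [hM4, hsum, hbt _ (by omega)]
  · rw [PostBetti.minGens_pts ha M' hM'1 (s + 1) hM'2]
    rw [hM'6]
    omega
end
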